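/- Let p ≥ 1, n ≥ 0, let f₀, …, fₙ : ℝ → ℝ be differentiable, set v(t) = (f₀(t), …, fₙ(t)) and assume v(t) ≠ 0 for all t; let γ(t) = v(t)/‖v(t)‖. Let A₀, …, Aₙ be random p×p real matrices all of whose p²(n+1) entries are independent standard normal random variables. Then for any reals a < b, the expected number of solutions t ∈ [a,b] of det( A₀f₀(t) + A₁f₁(t) + ⋯ + Aₙfₙ(t) ) = 0 equals √π · (Γ((p+1)/2)/Γ(p/2)) · (1/π) ∫_a^b ‖γ′(t)‖ dt. (Theorem 6.1, identity covariance case: the expected number of real eigenvalues of the random matrix polynomial is the p = 1 value multiplied by the geometric factor √π·Γ((p+1)/2)/Γ(p/2).) -/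

import Mathlib

open MeasureTheory ProbabilityTheory Real Set
open scoped ENNReal NNReal

theorem ENNReal.toENNReal_encard_iUnion {α : Type*} {s : ℕ → Set α}
    (hs : Pairwise (Function.onFun Disjoint s)) :
    ((⋃ n, s n).encard : ℝ≥0∞) = ∑' n, ((s n).encard : ℝ≥0∞) := by
  let _ : MeasurableSpace α := ⊤
  simp only [← Measure.count_apply (MeasurableSet.of_discrete)]
  exact measure_iUnion hs fun _ => MeasurableSet.of_discrete

theorem encard_fiber_of_injOn {α β : Type*} {f : α → β} {s : Set α} (hf : InjOn f s) (y : β) :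
    ({x | x ∈ s ∧ f x = y}.encard : ℝ≥0∞) = (f '' s).indicator 1 y := by
  by_cases hy : y ∈ f '' s
  · obtain ⟨x, hx, rfl⟩ := hy
    have : {z | z ∈ s ∧ f z = f x} = {x} := by
      ext z
      exact ⟨fun h => hf h.1 hx h.2, by rintro rfl; exact ⟨hx, rfl⟩⟩
    simp [this, mem_image_of_mem f hx]
  · have : {z | z ∈ s ∧ f z = y} = ∅ := by
      ext z
      simp only [mem_ofPred_eq, mem_empty_iff_false, iff_false]
      exact fun h => hy ⟨z, h.1, h.2⟩
    simp [this, hy]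

section Area

variable {E : Type*} [NormedAddCommGroup E] [NormedSpace ℝ E] [FiniteDimensional ℝ E]
  [MeasurableSpace E] [BorelSpace E] (μ : Measure E) [μ.IsAddHaarMeasure]
  {f : E → E} {f' : E → E →L[ℝ] E} {s : Set E}

/-- A set on which the derivative is invertible splits into countably many measurable pieces
on each of which the map is injective. -/
theorem exists_partition_injOn_of_det_ne_zero
    (hf' : ∀ x ∈ s, HasFDerivWithinAt f (f' x) s x) (h0 : ∀ x ∈ s, (f' x).det ≠ 0) :
    ∃ t : ℕ → Set E, Pairwise (Function.onFun Disjoint t) ∧ (∀ n, MeasurableSet (t n)) ∧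
      s ⊆ ⋃ n, t n ∧ ∀ n, InjOn f (s ∩ t n) := by
  rcases s.eq_empty_or_nonempty with rfl | hne
  · exact ⟨fun _ => ∅, fun _ _ _ => disjoint_bot_left, fun _ => MeasurableSet.empty,
      empty_subset _, fun n => by simp⟩
  have key : ∀ A : E →L[ℝ] E, ∃ r : ℝ≥0, r ≠ 0 ∧
      (A.det ≠ 0 → ∀ u : Set E, ApproximatesLinearOn f A u r → InjOn f u) := by
    intro A
    by_cases hA : A.det = 0
    · exact ⟨1, one_ne_zero, fun h => absurd hA h⟩
    · let B := A.toContinuousLinearEquivOfDetNeZero hA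
      have hB : (B : E →L[ℝ] E) = A := A.coe_toContinuousLinearEquivOfDetNeZero hA
      rcases subsingleton_or_nontrivial E with hE | hE
      · exact ⟨1, one_ne_zero, fun _ u _ => fun x _ y _ _ => Subsingleton.elim x y⟩
      · have hpos : 0 < ‖(B.symm : E →L[ℝ] E)‖₊⁻¹ := B.subsingleton_or_nnnorm_symm_pos.resolve_left
          (not_subsingleton E) |> inv_pos.2
        refine ⟨‖(B.symm : E →L[ℝ] E)‖₊⁻¹ / 2, (half_pos hpos).ne', fun _ u hu => ?_⟩
        rw [← hB] at hu
        exact hu.injOn (Or.inr (NNReal.half_lt_self hpos.ne'))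
  choose r hr0 hr using key
  obtain ⟨t, A, htd, htm, hst, happ, hA⟩ :=
    exists_partition_approximatesLinearOn_of_hasFDerivWithinAt f s f' hf' r hr0
  refine ⟨t, htd, htm, hst, fun n => hr (A n) ?_ _ (happ n)⟩
  obtain ⟨y, hy, hAy⟩ := hA hne n
  rw [hAy]
  exact h0 y hy

/-- Area formula with multiplicity for differentiable maps of a finite-dimensional space. -/
theorem lintegral_encard_fiber_mul (hs : MeasurableSet s)
    (hf' : ∀ x ∈ s, HasFDerivWithinAt f (f' x) s x)
    (hd : MeasurableSet {x | x ∈ s ∧ (f' x).det = 0}) {g : E → ℝ≥0∞} (hg : Measurable g) :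
    AEMeasurable (fun y => ({x | x ∈ s ∧ f x = y}.encard : ℝ≥0∞)) μ ∧
    ∫⁻ y, ({x | x ∈ s ∧ f x = y}.encard : ℝ≥0∞) * g y ∂μ =
      ∫⁻ x in s, ENNReal.ofReal |(f' x).det| * g (f x) ∂μ := by
  set s0 := {x | x ∈ s ∧ (f' x).det = 0} with hs0
  set s1 := s \ s0 with hs1
  have hs1m : MeasurableSet s1 := hs.diff hd
  have hs1s : s1 ⊆ s := sdiff_subset
  have hf1 : ∀ x ∈ s1, HasFDerivWithinAt f (f' x) s1 x := fun x hx => (hf' x (hs1s hx)).mono hs1s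
  obtain ⟨t, htd, htm, hst, hinj⟩ := exists_partition_injOn_of_det_ne_zero hf1
    (fun x hx h => hx.2 ⟨hx.1, h⟩)
  have hnull : μ (f '' s0) = 0 :=
    addHaar_image_eq_zero_of_det_fderivWithin_eq_zero μ
      (fun x hx => (hf' x hx.1).mono fun _ h => h.1) fun x hx => hx.2
  have hft : ∀ n, ∀ x ∈ s1 ∩ t n, HasFDerivWithinAt f (f' x) (s1 ∩ t n) x :=
    fun n x hx => (hf1 x hx.1).mono inter_subset_left
  have himg : ∀ n, MeasurableSet (f '' (s1 ∩ t n)) := fun n =>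
    measurable_image_of_fderivWithin (hs1m.inter (htm n)) (hft n) (hinj n)
  have hcount : (fun y => ({x | x ∈ s ∧ f x = y}.encard : ℝ≥0∞)) =ᵐ[μ]
      fun y => ∑' n, (f '' (s1 ∩ t n)).indicator 1 y := by
    filter_upwards [measure_eq_zero_iff_ae_notMem.1 hnull] with y hy
    have h1 : {x | x ∈ s ∧ f x = y} = ⋃ n, {x | x ∈ s1 ∩ t n ∧ f x = y} := by
      ext x
      simp only [mem_ofPred_eq, mem_iUnion]
      constructor
      · rintro ⟨hx, rfl⟩
        have hx1 : x ∈ s1 := ⟨hx, fun h => hy ⟨x, h, rfl⟩⟩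
        obtain ⟨n, hn⟩ := mem_iUnion.1 (hst hx1)
        exact ⟨n, ⟨hx1, hn⟩, rfl⟩
      · rintro ⟨n, hx, rfl⟩
        exact ⟨hs1s hx.1, rfl⟩
    rw [h1, ENNReal.toENNReal_encard_iUnion]
    · exact tsum_congr fun n => encard_fiber_of_injOn (hinj n) y
    · intro m n hmn
      exact (htd hmn).mono (fun x hx => hx.1.2) fun x hx => hx.1.2
  have hmeas : ∀ n, Measurable ((f '' (s1 ∩ t n)).indicator (1 : E → ℝ≥0∞)) :=
    fun n => measurable_one.indicator (himg n)
  refine ⟨(Measurable.tsum hmeas).aemeasurable.congr hcount.symm, ?_⟩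
  have e1 : ∫⁻ y, ({x | x ∈ s ∧ f x = y}.encard : ℝ≥0∞) * g y ∂μ =
      ∑' n, ∫⁻ y in f '' (s1 ∩ t n), g y ∂μ := by
    rw [lintegral_congr_ae (hcount.mono fun y hy =>
      show _ = (∑' n, (f '' (s1 ∩ t n)).indicator 1 y) * g y from congrArg (· * g y) hy)]
    simp_rw [← ENNReal.tsum_mul_right]
    rw [lintegral_tsum (f := fun n y => (f '' (s1 ∩ t n)).indicator 1 y * g y)
      fun n => ((hmeas n).mul hg).aemeasurable]
    refine tsum_congr fun n => ?_
    rw [← lintegral_indicator (himg n)]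
    refine lintegral_congr fun y => ?_
    by_cases hy : y ∈ f '' (s1 ∩ t n) <;> simp [hy]
  have e2 : ∫⁻ x in s, ENNReal.ofReal |(f' x).det| * g (f x) ∂μ =
      ∫⁻ x in s1, ENNReal.ofReal |(f' x).det| * g (f x) ∂μ := by
    rw [← lintegral_inter_add_sdiff _ s hd, ← hs1]
    have : ∫⁻ x in s ∩ s0, ENNReal.ofReal |(f' x).det| * g (f x) ∂μ = 0 := by
      rw [← lintegral_zero (μ := μ.restrict (s ∩ s0))]
      refine setLIntegral_congr_fun (hs.inter hd) fun x hx => ?_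
      simp [hx.2.2]
    rw [this, zero_add]
  rw [e1, e2]
  have h3 : s1 = ⋃ n, s1 ∩ t n := by
    rw [← inter_iUnion, inter_eq_left.2 hst]
  conv_rhs => rw [h3]
  rw [lintegral_iUnion (fun n => hs1m.inter (htm n))
    (fun m n hmn => (htd hmn).mono inter_subset_right inter_subset_right)]
  exact tsum_congr fun n =>
    lintegral_image_eq_lintegral_abs_det_fderiv_mul μ (hs1m.inter (htm n)) (hft n) (hinj n) g

end Area

theorem lintegral_fin_prod_eq_prod {n : ℕ} {X : Type*} [MeasurableSpace X]
    (μ : Fin n → Measure X) [∀ i, SigmaFinite (μ i)] {g : Fin n → X → ℝ≥0∞}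
    (hg : ∀ i, Measurable (g i)) :
    ∫⁻ x, ∏ i, g i (x i) ∂Measure.pi μ = ∏ i, ∫⁻ y, g i y ∂μ i := by
  induction n with
  | zero => simp
  | succ n ih =>
    have h := ((measurePreserving_piFinSuccAbove μ 0).symm _).lintegral_comp_emb
      (MeasurableEquiv.measurableEmbedding _) (fun x => ∏ i, g i (x i))
    rw [← h, Fin.prod_univ_succ, ← ih _ fun i => hg i.succ,
      ← lintegral_prod_mul (hg 0).aemeasurable
        (Finset.measurable_prod _ fun i _ => (hg i.succ).comp (measurable_pi_apply i)).aemeasurable]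
    refine lintegral_congr fun x => ?_
    rw [Fin.prod_univ_succ]
    rfl

theorem lintegral_pi_prod_eq_prod {ι : Type*} [Fintype ι] {X : Type*} [MeasurableSpace X]
    (μ : ι → Measure X) [∀ i, SigmaFinite (μ i)] {g : ι → X → ℝ≥0∞}
    (hg : ∀ i, Measurable (g i)) :
    ∫⁻ x, ∏ i, g i (x i) ∂Measure.pi μ = ∏ i, ∫⁻ y, g i y ∂μ i := by
  let e := (Fintype.equivFin ι).symm
  rw [← (measurePreserving_piCongrLeft μ e).lintegral_comp_emb
      (MeasurableEquiv.measurableEmbedding _), ← e.prod_comp,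
    ← lintegral_fin_prod_eq_prod (fun i => μ (e i)) fun i => hg (e i)]
  refine lintegral_congr fun x => ?_
  rw [← e.prod_comp]
  simp [MeasurableEquiv.coe_piCongrLeft, Equiv.piCongrLeft_apply_apply]

theorem pi_withDensity {ι : Type*} [Fintype ι] {X : Type*} [MeasurableSpace X]
    (μ : ι → Measure X) [∀ i, SigmaFinite (μ i)] {g : ι → X → ℝ≥0∞}
    (hg : ∀ i, Measurable (g i)) [∀ i, SigmaFinite ((μ i).withDensity (g i))] :
    Measure.pi (fun i => (μ i).withDensity (g i)) =
      (Measure.pi μ).withDensity fun x => ∏ i, g i (x i) := by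
  refine Measure.pi_eq fun s hs => ?_
  rw [withDensity_apply _ (MeasurableSet.univ_pi hs), ← lintegral_indicator (MeasurableSet.univ_pi hs)]
  simp only [withDensity_apply _ (hs _), ← lintegral_indicator (hs _)]
  rw [← lintegral_pi_prod_eq_prod μ fun i => (hg i).indicator (hs i)]
  refine lintegral_congr fun x => ?_
  by_cases hx : x ∈ univ.pi s
  · rw [indicator_of_mem hx]
    exact Finset.prod_congr rfl fun i _ => (indicator_of_mem (hx i trivial) _).symm
  · rw [indicator_of_notMem hx]
    simp only [mem_univ_pi, not_forall] at hx
    obtain ⟨i, hi⟩ := hx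
    exact (Finset.prod_eq_zero (Finset.mem_univ i) (indicator_of_notMem hi _)).symm

/-- The density of the standard Gaussian measure on `ι → ℝ`, up to its normalization. -/
theorem pi_gaussianReal_eq_withDensity (ι : Type*) [Fintype ι] :
    Measure.pi (fun _ : ι => gaussianReal 0 1) =
      (volume : Measure (ι → ℝ)).withDensity fun x =>
        ENNReal.ofReal ((√(2 * π))⁻¹ ^ Fintype.card ι * rexp (-(∑ i, x i ^ 2) / 2)) := by
  have h1 : gaussianReal 0 1 = (volume : Measure ℝ).withDensity (gaussianPDF 0 1) := by
    simp [gaussianReal]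
  have : SigmaFinite ((volume : Measure ℝ).withDensity (gaussianPDF 0 1)) := by
    rw [← h1]; infer_instance
  rw [h1, pi_withDensity _ fun _ => measurable_gaussianPDF 0 1]
  congr 1
  funext x
  simp only [gaussianPDF]
  rw [← ENNReal.ofReal_prod_of_nonneg fun i _ => gaussianPDFReal_nonneg 0 1 _]
  simp [gaussianPDFReal, Finset.prod_mul_distrib, ← Real.exp_sum, Finset.sum_div,
    Finset.sum_neg_distrib, neg_div]

theorem pi_pi_gaussianReal_eq_withDensity (κ ρ : Type*) [Fintype κ] [Fintype ρ] :
    Measure.pi (fun _ : κ => Measure.pi fun _ : ρ => gaussianReal 0 1) =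
      (volume : Measure (κ → ρ → ℝ)).withDensity fun x =>
        ENNReal.ofReal ((√(2 * π))⁻¹ ^ (Fintype.card κ * Fintype.card ρ) *
          rexp (-(∑ k, ∑ r, x k r ^ 2) / 2)) := by
  have : SigmaFinite ((volume : Measure (ρ → ℝ)).withDensity fun x =>
        ENNReal.ofReal ((√(2 * π))⁻¹ ^ Fintype.card ρ * rexp (-(∑ i, x i ^ 2) / 2))) := by
    rw [← pi_gaussianReal_eq_withDensity]; infer_instance
  rw [pi_gaussianReal_eq_withDensity, pi_withDensity _ fun _ => by fun_prop]
  congr 1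
  funext x
  rw [← ENNReal.ofReal_prod_of_nonneg fun i _ => by positivity, Finset.prod_mul_distrib,
    Finset.prod_const, ← Real.exp_sum, ← pow_mul, mul_comm (Fintype.card κ)]
  simp [Finset.sum_div, Finset.sum_neg_distrib, neg_div]

theorem lintegral_exp_neg_mul_sum_sq (ι : Type*) [Fintype ι] {b : ℝ} (hb : 0 < b) :
    ∫⁻ x : ι → ℝ, ENNReal.ofReal (rexp (-b * ∑ i, x i ^ 2)) =
      ENNReal.ofReal (√(π / b) ^ Fintype.card ι) := by
  have h1 : ∫⁻ x : ℝ, ENNReal.ofReal (rexp (-b * x ^ 2)) = ENNReal.ofReal √(π / b) := by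
    rw [← integral_gaussian, ofReal_integral_eq_lintegral_ofReal (integrable_exp_neg_mul_sq hb)
      (Filter.Eventually.of_forall fun x => (Real.exp_pos _).le)]
  have h2 := lintegral_pi_prod_eq_prod (fun _ : ι => (volume : Measure ℝ))
    (g := fun _ x => ENNReal.ofReal (rexp (-b * x ^ 2))) (fun _ => by fun_prop)
  rw [Finset.prod_const, h1, Finset.card_univ, ← ENNReal.ofReal_pow (by positivity)] at h2
  rw [← h2, volume_pi]
  refine lintegral_congr fun x => ?_
  rw [← ENNReal.ofReal_prod_of_nonneg fun i _ => (Real.exp_pos _).le, ← Real.exp_sum,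
    Finset.mul_sum]

/-- Uncurrying preserves product measures. -/
theorem measurePreserving_uncurry {α β X : Type*} [Fintype α] [Fintype β] [MeasurableSpace X]
    (μ : Measure X) [SigmaFinite μ] :
    MeasurePreserving (fun (x : α → β → X) (k : α × β) => x k.1 k.2)
      (Measure.pi fun _ => Measure.pi fun _ => μ) (Measure.pi fun _ => μ) := by
  refine ⟨by fun_prop, (Measure.pi_eq fun s hs => ?_).symm⟩
  rw [Measure.map_apply (by fun_prop) (MeasurableSet.univ_pi hs)]
  have : (fun (x : α → β → X) (k : α × β) => x k.1 k.2) ⁻¹' univ.pi s =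
      univ.pi fun a => univ.pi fun b => s (a, b) := by
    ext x; simp
  rw [this]
  simp [Measure.pi_pi, Fintype.prod_prod_type]

section Hyperplane

variable {κ ρ : Type*} [Fintype κ] [Fintype ρ]

/-- The product of a function on matrices with rows indexed by `ρ`, integrated over the matrices
whose rows are orthogonal to `(q, q₀)`, against a Gaussian weight. -/
theorem lintegral_hyperplane (q : κ → ℝ) {q₀ : ℝ} (hq₀ : q₀ ≠ 0) {Q : ℝ} (hQ : 0 < Q)
    (hQq : Q ^ 2 = ∑ k, q k ^ 2 + q₀ ^ 2)
    {F : (κ → ρ → ℝ) × (ρ → ℝ) → ℝ≥0∞} (hF : Measurable F) :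
    ∫⁻ z : κ → ρ → ℝ, F (z, fun r => -(q₀⁻¹ * ∑ k, q k * z k r)) *
        ENNReal.ofReal (rexp (-(∑ k, ∑ r, z k r ^ 2 + ∑ r, (q₀⁻¹ * ∑ k, q k * z k r) ^ 2) / 2)) =
      ENNReal.ofReal ((|q₀| / (√(2 * π) * Q)) ^ Fintype.card ρ) *
        ∫⁻ x : (κ → ρ → ℝ) × (ρ → ℝ),
          F (fun k r => x.1 k r - q k / Q ^ 2 * (∑ l, q l * x.1 l r + q₀ * x.2 r),
            fun r => x.2 r - q₀ / Q ^ 2 * (∑ l, q l * x.1 l r + q₀ * x.2 r)) *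
          ENNReal.ofReal (rexp (-(∑ k, ∑ r, x.1 k r ^ 2 + ∑ r, x.2 r ^ 2) / 2)) := by
  set H : (κ → ρ → ℝ) × (ρ → ℝ) → ℝ≥0∞ := fun x =>
          F (fun k r => x.1 k r - q k / Q ^ 2 * (∑ l, q l * x.1 l r + q₀ * x.2 r),
            fun r => x.2 r - q₀ / Q ^ 2 * (∑ l, q l * x.1 l r + q₀ * x.2 r)) *
          ENNReal.ofReal (rexp (-(∑ k, ∑ r, x.1 k r ^ 2 + ∑ r, x.2 r ^ 2) / 2)) with hH
  have hHm : Measurable H := by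
    refine (hF.comp ?_).mul ?_ <;> fun_prop
  set Ψ : (κ → ρ → ℝ) → ρ → ℝ := fun z r => -(q₀⁻¹ * ∑ k, q k * z k r) with hΨ
  set s : (ρ → ℝ) → κ → ρ → ℝ := fun y k r => q₀ * q k / Q ^ 2 * y r with hs
  have hΨm : Measurable Ψ := by fun_prop
  have hsum (z : κ → ρ → ℝ) (y : ρ → ℝ) (r : ρ) :
      ∑ l, q l * (s y + z) l r = q₀ * (Q ^ 2 - q₀ ^ 2) / Q ^ 2 * y r + ∑ l, q l * z l r := by
    simp only [hs, Pi.add_apply, mul_add, Finset.sum_add_distrib]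
    rw [hQq, add_sub_cancel_right, Finset.mul_sum, Finset.sum_div, Finset.sum_mul]
    congr 1
    refine Finset.sum_congr rfl fun l _ => ?_
    ring
  have key (z : κ → ρ → ℝ) (y : ρ → ℝ) : H (s y + z, Ψ (s y + z) + y) =
      (F (z, Ψ z) * ENNReal.ofReal (rexp (-(∑ k, ∑ r, z k r ^ 2 + ∑ r, (q₀⁻¹ * ∑ k, q k * z k r) ^ 2) / 2)))
        * ENNReal.ofReal (rexp (-(q₀ ^ 2 / (2 * Q ^ 2)) * ∑ r, y r ^ 2)) := by
    have hY (r : ρ) : ∑ l, q l * (s y + z) l r + q₀ * (Ψ (s y + z) + y) r = q₀ * y r := by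
      simp only [hΨ, Pi.add_apply] at hsum ⊢
      rw [hsum]
      field_simp
      ring
    simp only [hH, hY]
    rw [mul_assoc, ← ENNReal.ofReal_mul (Real.exp_pos _).le, ← Real.exp_add]
    congr 3
    · funext k r
      simp only [hs, Pi.add_apply]
      ring
    · funext r
      simp only [hΨ, Pi.add_apply] at hsum ⊢
      rw [hsum]
      field_simp
      ring
    · have h1 : ∑ k, ∑ r, (s y + z) k r ^ 2 + ∑ r, (Ψ (s y + z) + y) r ^ 2 =
          ∑ r, (∑ k, (s y + z) k r ^ 2 + (Ψ (s y + z) + y) r ^ 2) := by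
        rw [Finset.sum_comm, Finset.sum_add_distrib]
      have h2 : ∑ k, ∑ r, z k r ^ 2 + ∑ r, (q₀⁻¹ * ∑ k, q k * z k r) ^ 2 =
          ∑ r, (∑ k, z k r ^ 2 + (q₀⁻¹ * ∑ k, q k * z k r) ^ 2) := by
        rw [Finset.sum_comm, Finset.sum_add_distrib]
      rw [h1, h2]
      have h3 (r : ρ) : ∑ k, (s y + z) k r ^ 2 + (Ψ (s y + z) + y) r ^ 2 =
          (∑ k, z k r ^ 2 + (q₀⁻¹ * ∑ k, q k * z k r) ^ 2) + q₀ ^ 2 / Q ^ 2 * y r ^ 2 := by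
        have h4 : ∑ k, (s y + z) k r ^ 2 = ∑ k, z k r ^ 2 +
            (q₀ * y r / Q ^ 2) ^ 2 * (Q ^ 2 - q₀ ^ 2) +
              2 * (q₀ * y r / Q ^ 2) * ∑ k, q k * z k r := by
          rw [hQq, add_sub_cancel_right, ← hQq, Finset.mul_sum, Finset.mul_sum,
            ← Finset.sum_add_distrib, ← Finset.sum_add_distrib]
          refine Finset.sum_congr rfl fun k _ => ?_
          simp only [hs, Pi.add_apply]
          ring
        rw [h4]
        simp only [hΨ, Pi.add_apply] at hsum ⊢
        rw [hsum]
        field_simp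
        ring
      simp only [h3, Finset.sum_add_distrib, ← Finset.mul_sum]
      ring
  have hR : ∫⁻ x, H x = (∫⁻ z, F (z, Ψ z) * ENNReal.ofReal (rexp (-(∑ k, ∑ r, z k r ^ 2 + ∑ r, (q₀⁻¹ * ∑ k, q k * z k r) ^ 2) / 2)))
        * ENNReal.ofReal (√(π / (q₀ ^ 2 / (2 * Q ^ 2))) ^ Fintype.card ρ) := by
    rw [← lintegral_exp_neg_mul_sum_sq ρ (by positivity)]
    calc ∫⁻ x, H x = ∫⁻ z, ∫⁻ y, H (z, y) := by
          rw [Measure.volume_eq_prod, lintegral_prod _ hHm.aemeasurable]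
      _ = ∫⁻ z, ∫⁻ y, H (z, Ψ z + y) := by
          refine lintegral_congr fun z => ?_
          rw [lintegral_add_left_eq_self (fun y => H (z, y))]
      _ = ∫⁻ y, ∫⁻ z, H (z, Ψ z + y) := by
          rw [lintegral_lintegral_swap]
          fun_prop
      _ = ∫⁻ y, ∫⁻ z, H (s y + z, Ψ (s y + z) + y) := by
          refine lintegral_congr fun y => ?_
          rw [lintegral_add_left_eq_self (fun z => H (z, Ψ z + y))]
      _ = _ := by
          simp only [key]
          rw [← lintegral_const_mul _ (by fun_prop)]
          refine lintegral_congr fun y => ?_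
          rw [lintegral_mul_const]
          exact (hF.comp (by fun_prop)).mul (by fun_prop)
  rw [hR, mul_comm, mul_assoc, ← ENNReal.ofReal_mul (by positivity), ← mul_pow]
  have : √(π / (q₀ ^ 2 / (2 * Q ^ 2))) * (|q₀| / (√(2 * π) * Q)) = 1 := by
    have : π / (q₀ ^ 2 / (2 * Q ^ 2)) = (2 * π) * (Q / |q₀|) ^ 2 := by
      rw [div_pow, sq_abs]; field_simp
    rw [this, Real.sqrt_mul (by positivity), Real.sqrt_sq (by positivity)]
    have : |q₀| ≠ 0 := abs_ne_zero.mpr hq₀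
    field_simp
  rw [this, one_pow, ENNReal.ofReal_one, mul_one]

end Hyperplane

theorem charFunDual_pi_gaussianReal {ι : Type*} [Fintype ι] [DecidableEq ι]
    (L : StrongDual ℝ (ι → ℝ)) :
    charFunDual (Measure.pi fun _ : ι => gaussianReal 0 1) L =
      Complex.exp ((-(∑ i, L (Pi.single i 1) ^ 2) / 2 : ℝ)) := by
  obtain ⟨l, hl⟩ : ∃ l : ι → ℝ, ∀ i, l i = L (Pi.single i 1) := ⟨_, fun _ => rfl⟩
  have hL (x : ι → ℝ) : L x = ∑ i, l i * x i := by
    simp only [hl]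
    conv_lhs => rw [pi_eq_sum_univ' x]
    simp [mul_comm]
  rw [charFunDual_apply]
  simp only [← hl]
  simp_rw [hL, Complex.ofReal_sum, Finset.sum_mul, Complex.exp_sum,
    integral_fintype_prod_eq_prod
      (f := fun i (x : ℝ) => Complex.exp (((l i * x : ℝ) : ℂ) * Complex.I)),
    Complex.ofReal_mul, ← charFun_apply_real, charFun_gaussianReal]
  rw [← Complex.exp_sum]
  simp [Finset.sum_div, neg_div]

theorem measurable_vecMul {ι ρ : Type*} [Fintype ι] (N : Matrix ι ρ ℝ) :
    Measurable fun a : ι → ℝ => Matrix.vecMul a N := by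
  simp only [Matrix.vecMul_eq_sum]
  fun_prop

theorem charFunDual_map_pi_gaussianReal {ι ρ : Type*} [Fintype ι] [Fintype ρ] [DecidableEq ρ]
    (N : Matrix ι ρ ℝ) (L : StrongDual ℝ (ρ → ℝ)) :
    charFunDual ((Measure.pi fun _ : ι => gaussianReal 0 1).map (fun a => Matrix.vecMul a N)) L =
      Complex.exp ((-(∑ c, ∑ d, (N.transpose * N) c d *
        (L (Pi.single c 1) * L (Pi.single d 1))) / 2 : ℝ)) := by
  classical
  have := charFunDual_map (μ := Measure.pi fun _ : ι => gaussianReal 0 1)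
    (Matrix.vecMulLinear N).toContinuousLinearMap L
  rw [LinearMap.coe_toContinuousLinearMap'] at this
  change charFunDual ((Measure.pi fun _ : ι => gaussianReal 0 1).map
    (fun a => Matrix.vecMul a N)) L = _ at this
  rw [this, charFunDual_pi_gaussianReal]
  congr 4
  have h1 (i : ι) : (L.comp (Matrix.vecMulLinear N).toContinuousLinearMap) (Pi.single i 1) =
      ∑ c, N i c * L (Pi.single c 1) := by
    simp only [ContinuousLinearMap.comp_apply, LinearMap.coe_toContinuousLinearMap',
      Matrix.vecMulLinear_apply, Matrix.single_one_vecMul]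
    conv_lhs => rw [pi_eq_sum_univ' (N.row i)]
    simp
  simp only [h1, sq, Matrix.mul_apply, Finset.sum_mul, Matrix.transpose_apply]
  rw [Finset.sum_comm]
  refine Finset.sum_congr rfl fun c _ => ?_
  simp only [Finset.mul_sum]
  rw [Finset.sum_comm]
  refine Finset.sum_congr rfl fun d _ => Finset.sum_congr rfl fun i _ => ?_
  ring

/-- The law of the image of a standard Gaussian vector under a matrix `N` depends only on `NᵀN`. -/
theorem map_pi_gaussianReal_eq_of_gram_eq {ι κ ρ : Type*} [Fintype ι] [Fintype κ] [Fintype ρ]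
    {N : Matrix ι ρ ℝ} {R : Matrix κ ρ ℝ} (h : N.transpose * N = R.transpose * R) :
    (Measure.pi fun _ : ι => gaussianReal 0 1).map (fun a => Matrix.vecMul a N) =
      (Measure.pi fun _ : κ => gaussianReal 0 1).map (fun a => Matrix.vecMul a R) := by
  classical
  have h1 : IsProbabilityMeasure ((Measure.pi fun _ : ι => gaussianReal 0 1).map
    (fun a => Matrix.vecMul a N)) := Measure.isProbabilityMeasure_map (measurable_vecMul N).aemeasurable
  have h2 : IsProbabilityMeasure ((Measure.pi fun _ : κ => gaussianReal 0 1).map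
    (fun a => Matrix.vecMul a R)) := Measure.isProbabilityMeasure_map (measurable_vecMul R).aemeasurable
  refine Measure.ext_of_charFunDual ?_
  ext L
  rw [charFunDual_map_pi_gaussianReal, h, ← charFunDual_map_pi_gaussianReal]

/-- Transposition preserves product measures. -/
theorem measurePreserving_flip {α β X : Type*} [Fintype α] [Fintype β] [MeasurableSpace X]
    (μ : Measure X) [SigmaFinite μ] :
    MeasurePreserving (fun (x : α → β → X) (b : β) (a : α) => x a b)
      (Measure.pi fun _ => Measure.pi fun _ => μ) (Measure.pi fun _ => Measure.pi fun _ => μ) := by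
  have h1 : MeasurePreserving (MeasurableEquiv.curry β α X).symm
      (Measure.pi fun _ => Measure.pi fun _ => μ) (Measure.pi fun _ => μ) :=
    measurePreserving_uncurry μ
  have h2 := measurePreserving_piCongrLeft (fun _ : β × α => μ) (Equiv.prodComm α β)
  have h3 := (h1.symm.comp h2).comp (measurePreserving_uncurry (α := α) (β := β) μ)
  have h4 : (fun (x : α → β → X) (b : β) (a : α) => x a b) =
      ((MeasurableEquiv.curry β α X).symm.symm ∘
        MeasurableEquiv.piCongrLeft (fun _ => X) (Equiv.prodComm α β)) ∘
          fun x k => x k.1 k.2 := by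
    funext x b a
    rfl
  rw [h4]
  exact h3

/-- The expected absolute value of the determinant of a Gaussian matrix. -/
noncomputable def gaussianAbsDet (ρ : Type*) [Fintype ρ] [DecidableEq ρ] : ℝ≥0∞ :=
  ∫⁻ G : ρ → ρ → ℝ, ENNReal.ofReal |(Matrix.of G).det|
    ∂(Measure.pi fun _ => Measure.pi fun _ => gaussianReal 0 1)

theorem lintegral_abs_det_gaussian_mul_eq_map {ι ρ : Type*} [Fintype ι] [Fintype ρ]
    [DecidableEq ρ] (M : Matrix ι ρ ℝ) :
    ∫⁻ A : ρ → ι → ℝ, ENNReal.ofReal |(Matrix.of A * M).det|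
        ∂(Measure.pi fun _ => Measure.pi fun _ => gaussianReal 0 1) =
      ∫⁻ B : ρ → ρ → ℝ, ENNReal.ofReal |(Matrix.of B).det| ∂(Measure.pi fun _ =>
        (Measure.pi fun _ : ι => gaussianReal 0 1).map (fun a => Matrix.vecMul a M)) := by
  have hM := measurable_vecMul M
  have : IsProbabilityMeasure ((Measure.pi fun _ : ι => gaussianReal 0 1).map
      (fun a => Matrix.vecMul a M)) := Measure.isProbabilityMeasure_map hM.aemeasurable
  rw [← Measure.pi_map_pi (fun _ => hM.aemeasurable), lintegral_map]
  · rfl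
  · simp only [Matrix.det_apply]
    fun_prop
  · fun_prop

theorem lintegral_abs_det_gaussian_mul {κ ρ : Type*} [Fintype κ] [Fintype ρ] [DecidableEq ρ]
    (N : Matrix κ ρ ℝ) :
    ∫⁻ A : ρ → κ → ℝ, ENNReal.ofReal |(Matrix.of A * N).det|
        ∂(Measure.pi fun _ => Measure.pi fun _ => gaussianReal 0 1) =
      ENNReal.ofReal √(N.transpose * N).det * gaussianAbsDet ρ := by
  obtain ⟨R, hR⟩ : ∃ R : Matrix ρ ρ ℝ, N.transpose * N = R.transpose * R := by
    have hpos : (N.transpose * N).PosSemidef := by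
      simpa using Matrix.posSemidef_conjTranspose_mul_self N
    open scoped MatrixOrder Matrix.Norms.L2Operator in
    obtain ⟨R, hR⟩ := CStarAlgebra.nonneg_iff_eq_star_mul_self.mp hpos.nonneg
    exact ⟨R, by simpa [Matrix.star_eq_conjTranspose] using hR⟩
  rw [lintegral_abs_det_gaussian_mul_eq_map, map_pi_gaussianReal_eq_of_gram_eq hR,
    ← lintegral_abs_det_gaussian_mul_eq_map, hR, Matrix.det_mul, Matrix.det_transpose,
    Real.sqrt_mul_self_eq_abs, gaussianAbsDet, ← lintegral_const_mul]
  · refine lintegral_congr fun A => ?_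
    rw [Matrix.det_mul, abs_mul, mul_comm, ENNReal.ofReal_mul (abs_nonneg _)]
  · simp only [Matrix.det_apply]
    fun_prop

theorem lintegral_sqrt_sum_sq_gaussian (m : ℕ) :
    ∫⁻ x : Fin (m + 1) → ℝ, ENNReal.ofReal √(∑ i, x i ^ 2) ∂(Measure.pi fun _ => gaussianReal 0 1) =
      ENNReal.ofReal (√2 * Gamma (((m : ℝ) + 2) / 2) / Gamma (((m : ℝ) + 1) / 2)) := by
  set E := EuclideanSpace ℝ (Fin (m + 1))
  have hgam (q : ℕ) : 0 < Gamma (((q : ℝ) + 1) / 2) := Gamma_pos_of_pos (by positivity)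
  have hrad (q : ℕ) : ∫ y in Ioi (0 : ℝ), y ^ q * rexp (-y ^ 2 / 2) =
      √2 ^ (q + 1) * (1 / 2) * Gamma (((q : ℝ) + 1) / 2) := by
    have h := integral_rpow_mul_exp_neg_mul_rpow (p := 2) (q := q) (b := 1 / 2) (by norm_num)
      (by have : (0 : ℝ) ≤ q := q.cast_nonneg
          linarith) (by norm_num)
    have h2 : ((1 / 2 : ℝ)) ^ (-((q : ℝ) + 1) / 2) = √2 ^ (q + 1) := by
      rw [one_div, Real.inv_rpow (by norm_num), ← Real.rpow_neg (by norm_num), Real.sqrt_eq_rpow,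
        ← Real.rpow_natCast, ← Real.rpow_mul (by norm_num)]
      congr 1
      push_cast
      ring
    rw [h2] at h
    rw [← h]
    refine setIntegral_congr_fun measurableSet_Ioi fun y _ => ?_
    simp only [Real.rpow_natCast, Real.rpow_ofNat]
    congr 2
    ring
  set C : ℝ := ((m + 1 : ℕ) : ℝ) * (volume : Measure E).real (Metric.ball 0 1) with hC
  have hCpos : 0 < C := by
    refine mul_pos (by positivity) ?_
    exact ENNReal.toReal_pos (Metric.measure_ball_pos _ _ one_pos).ne' measure_ball_lt_top.ne
  have hpol (q : ℕ) : ∫ x : E, ‖x‖ ^ q * rexp (-‖x‖ ^ 2 / 2) =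
      C * (√2 ^ (m + q + 1) * (1 / 2) * Gamma (((m + q : ℕ) + 1 : ℝ) / 2)) := by
    rw [integral_fun_norm_addHaar volume (fun r => r ^ q * rexp (-r ^ 2 / 2)), ← hrad]
    simp [E, hC, nsmul_eq_mul, mul_assoc, pow_add]
  have hl (q : ℕ) : ∫⁻ x : Fin (m + 1) → ℝ,
      ENNReal.ofReal (√(∑ i, x i ^ 2) ^ q * rexp (-(∑ i, x i ^ 2) / 2)) =
      ENNReal.ofReal (C * (√2 ^ (m + q + 1) * (1 / 2) * Gamma (((m + q : ℕ) + 1 : ℝ) / 2))) := by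
    rw [← hpol, ofReal_integral_eq_lintegral_ofReal]
    · rw [← (PiLp.volume_preserving_ofLp (Fin (m + 1))).lintegral_comp (by fun_prop)]
      refine lintegral_congr fun x => ?_
      rw [EuclideanSpace.norm_eq, neg_div, neg_div, Real.sq_sqrt (by positivity)]
      simp only [Real.norm_eq_abs, sq_abs]
    · refine Integrable.of_integral_ne_zero ?_
      rw [hpol]
      have := hgam (m + q)
      positivity
    · exact Filter.Eventually.of_forall fun x => by positivity
  have hn : (√(2 * π))⁻¹ ^ (m + 1) * (C * (√2 ^ (m + 1) * (1 / 2) * Gamma (((m : ℝ) + 1) / 2))) = 1 := by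
    have h0 := hl 0
    have h1 := lintegral_exp_neg_mul_sum_sq (Fin (m + 1)) (b := 1 / 2) (by norm_num)
    simp only [pow_zero, one_mul, add_zero] at h0
    have h2 : √(π / (1 / 2)) = √(2 * π) := by congr 1; ring
    rw [h2, Fintype.card_fin] at h1
    have h3 : ENNReal.ofReal (√(2 * π) ^ (m + 1)) =
        ENNReal.ofReal (C * (√2 ^ (m + 1) * (1 / 2) * Gamma (((m : ℝ) + 1) / 2))) := by
      rw [← h0, ← h1]
      congr! 4 with x
      ring
    have := hgam m
    rw [ENNReal.ofReal_eq_ofReal_iff (by positivity) (by positivity)] at h3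
    rw [← h3, ← mul_pow, inv_mul_cancel₀ (by positivity), one_pow]
  have h1 := hl 1
  rw [pi_gaussianReal_eq_withDensity, lintegral_withDensity_eq_lintegral_mul _ (by fun_prop) (by fun_prop)]
  have h2 (x : Fin (m + 1) → ℝ) : ((fun x : Fin (m + 1) → ℝ => ENNReal.ofReal
      ((√(2 * π))⁻¹ ^ Fintype.card (Fin (m + 1)) * rexp (-(∑ i, x i ^ 2) / 2))) *
      (fun x => ENNReal.ofReal √(∑ i, x i ^ 2) : (Fin (m + 1) → ℝ) → ℝ≥0∞)) x = ENNReal.ofReal ((√(2 * π))⁻¹ ^ (m + 1)) *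
        ENNReal.ofReal (√(∑ i, x i ^ 2) ^ 1 * rexp (-(∑ i, x i ^ 2) / 2)) := by
    rw [Pi.mul_apply, ← ENNReal.ofReal_mul (by positivity), ← ENNReal.ofReal_mul (by positivity),
      Fintype.card_fin]
    congr 1
    ring
  simp only [h2]
  rw [lintegral_const_mul _ (by fun_prop), h1, ← ENNReal.ofReal_mul (by positivity)]
  congr 1
  have := hgam m
  rw [eq_div_iff this.ne']
  have h3 : ((m + 1 : ℕ) + 1 : ℝ) / 2 = ((m : ℝ) + 2) / 2 := by push_cast; ring
  rw [h3]
  linear_combination √2 * Gamma (((m : ℝ) + 2) / 2) * hn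

theorem exists_orthogonal_vecMul_eq {m : ℕ} (x : Fin (m + 1) → ℝ) :
    ∃ O : Matrix (Fin (m + 1)) (Fin (m + 1)) ℝ, O.transpose * O = 1 ∧
      Matrix.vecMul x O = Pi.single 0 √(∑ i, x i ^ 2) := by
  obtain ⟨e, he, hxe⟩ : ∃ e : EuclideanSpace ℝ (Fin (m + 1)), ‖e‖ = 1 ∧
      WithLp.toLp 2 x = √(∑ i, x i ^ 2) • e := by
    by_cases hx : x = 0
    · exact ⟨EuclideanSpace.single 0 1, by simp, by simp [hx]⟩
    · have hx' : WithLp.toLp 2 x ≠ 0 := by simpa using hx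
      have : √(∑ i, x i ^ 2) = ‖WithLp.toLp 2 x‖ := by simp [EuclideanSpace.norm_eq]
      refine ⟨‖WithLp.toLp 2 x‖⁻¹ • WithLp.toLp 2 x, norm_smul_inv_norm hx', ?_⟩
      rw [this, smul_smul, mul_inv_cancel₀ (norm_ne_zero_iff.mpr hx'), one_smul]
  obtain ⟨b, hb⟩ := Orthonormal.exists_orthonormalBasis_extension_of_card_eq (𝕜 := ℝ)
    (ι := Fin (m + 1)) (by simp) (v := fun _ => e) (s := {0})
    ⟨fun i => he, fun i j hij => (hij (Subsingleton.elim i j)).elim⟩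
  have hb0 : b 0 = e := hb 0 rfl
  refine ⟨Matrix.of fun k j => b j k, ?_, ?_⟩
  · ext i j
    have := (orthonormal_iff_ite.mp b.orthonormal) i j
    simp only [PiLp.inner_apply] at this
    simp [Matrix.mul_apply, Matrix.one_apply, ← this, mul_comm]
  · ext j
    have h1 : Matrix.vecMul x (Matrix.of fun k j => b j k) j =
        inner ℝ (b j) (WithLp.toLp 2 x) := by
      simp [Matrix.vecMul, dotProduct, PiLp.inner_apply]
    rw [h1, hxe, inner_smul_right, ← hb0, orthonormal_iff_ite.mp b.orthonormal]
    simp [Pi.single_apply]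

theorem measurable_ofReal_abs_det {ρ : Type*} [Fintype ρ] [DecidableEq ρ] :
    Measurable fun G : ρ → ρ → ℝ => ENNReal.ofReal |(Matrix.of G).det| := by
  simp only [Matrix.det_apply]
  fun_prop

theorem lintegral_abs_det_cons (m : ℕ) (x : Fin (m + 1) → ℝ) :
    ∫⁻ A : Fin m → Fin (m + 1) → ℝ, ENNReal.ofReal
        |(Matrix.of (Fin.cons x A : Fin (m + 1) → Fin (m + 1) → ℝ)).det|
        ∂(Measure.pi fun _ => Measure.pi fun _ => gaussianReal 0 1) =
      ENNReal.ofReal √(∑ i, x i ^ 2) * gaussianAbsDet (Fin m) := by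
  obtain ⟨O, hO, hxO⟩ := exists_orthogonal_vecMul_eq x
  set N := O.submatrix id Fin.succ with hN
  have hNN : N.transpose * N = 1 := by
    ext i j
    have := congrFun (congrFun hO i.succ) j.succ
    simpa [Matrix.mul_apply, hN, Matrix.one_apply] using this
  have hdetO : |O.det| = 1 := by
    have := congrArg Matrix.det hO
    rw [Matrix.det_mul, Matrix.det_transpose, Matrix.det_one] at this
    rw [← sq_eq_sq₀ (abs_nonneg _) zero_le_one, sq_abs, sq, this, one_pow]
  have h := lintegral_abs_det_gaussian_mul N
  rw [hNN, Matrix.det_one, Real.sqrt_one, ENNReal.ofReal_one, one_mul] at h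
  rw [← h, ← lintegral_const_mul]
  · refine lintegral_congr fun A => ?_
    rw [← ENNReal.ofReal_mul (by positivity)]
    congr 1
    have h1 : |(Matrix.of (Fin.cons x A : Fin (m + 1) → Fin (m + 1) → ℝ)).det| =
        |(Matrix.of (Fin.cons x A : Fin (m + 1) → Fin (m + 1) → ℝ) * O).det| := by
      rw [Matrix.det_mul, abs_mul, hdetO, mul_one]
    have h0 (j) : (Matrix.of (Fin.cons x A : Fin (m + 1) → Fin (m + 1) → ℝ) * O) 0 j =
        (Pi.single 0 √(∑ i, x i ^ 2) : Fin (m + 1) → ℝ) j := by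
      rw [← hxO]; rfl
    rw [h1, Matrix.det_succ_row_zero, Fin.sum_univ_succ]
    simp only [h0]
    simp only [Pi.single_eq_same, Fin.val_zero, pow_zero, one_mul, Pi.single_apply,
      Fin.succ_ne_zero, if_false, mul_zero, zero_mul, Finset.sum_const_zero, add_zero, abs_mul]
    rw [abs_of_nonneg (Real.sqrt_nonneg _)]
    rfl
  · exact measurable_ofReal_abs_det.comp (f := fun A : Fin m → Fin (m + 1) → ℝ =>
      (fun i => Matrix.vecMul (A i) N : Fin m → Fin m → ℝ))
      (measurable_pi_lambda _ fun i => (measurable_vecMul N).comp (measurable_pi_apply i))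

theorem gaussianAbsDet_succ (m : ℕ) : gaussianAbsDet (Fin (m + 1)) =
    ENNReal.ofReal (√2 * Gamma (((m : ℝ) + 2) / 2) / Gamma (((m : ℝ) + 1) / 2)) *
      gaussianAbsDet (Fin m) := by
  rw [← lintegral_sqrt_sum_sq_gaussian, ← lintegral_mul_const _ (by fun_prop)]
  simp only [← lintegral_abs_det_cons]
  rw [gaussianAbsDet]
  have h := ((measurePreserving_piFinSuccAbove (fun _ : Fin (m + 1) =>
      Measure.pi fun _ : Fin (m + 1) => gaussianReal 0 1) 0).symm _).lintegral_comp_emb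
    (MeasurableEquiv.measurableEmbedding _) (fun G => ENNReal.ofReal |(Matrix.of G).det|)
  rw [← h, lintegral_prod]
  · have (x : Fin (m + 1) → ℝ) (A : Fin m → Fin (m + 1) → ℝ) :
        (MeasurableEquiv.piFinSuccAbove (fun _ : Fin (m + 1) => Fin (m + 1) → ℝ) 0).symm (x, A) =
          Fin.cons x A := by
      rw [MeasurableEquiv.piFinSuccAbove_symm_apply]
      exact Fin.insertNth_zero' x A
    simp only [this]
  · exact (measurable_ofReal_abs_det.comp (MeasurableEquiv.measurable _)).aemeasurable

theorem gaussianAbsDet_fin (m : ℕ) : gaussianAbsDet (Fin m) =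
    ENNReal.ofReal (√2 ^ m * Gamma (((m : ℝ) + 1) / 2) / √π) := by
  induction m with
  | zero =>
    rw [Nat.cast_zero, zero_add, Real.Gamma_one_half_eq, pow_zero, one_mul,
      div_self (Real.sqrt_ne_zero'.mpr Real.pi_pos)]
    simp [gaussianAbsDet]
  | succ m ih =>
    rw [gaussianAbsDet_succ, ih, ← ENNReal.ofReal_mul]
    · congr 1
      have : 0 < Gamma (((m : ℝ) + 1) / 2) := Gamma_pos_of_pos (by positivity)
      push_cast
      rw [show (m : ℝ) + 1 + 1 = m + 2 by ring]
      field_simp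
      ring
    · have h1 : 0 < Gamma (((m : ℝ) + 1) / 2) := Gamma_pos_of_pos (by positivity)
      have h2 : 0 < Gamma (((m : ℝ) + 2) / 2) := Gamma_pos_of_pos (by positivity)
      positivity

theorem lintegral_rpow_mul_exp_neg_mul_Ioi {a r : ℝ} (ha : 0 < a) (hr : 0 < r) :
    ∫⁻ t in Ioi (0 : ℝ), ENNReal.ofReal (t ^ (a - 1) * rexp (-(r * t))) =
      ENNReal.ofReal ((1 / r) ^ a * Gamma a) := by
  have h := Real.integral_rpow_mul_exp_neg_mul_Ioi ha hr
  have := Gamma_pos_of_pos ha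
  rw [← h, ofReal_integral_eq_lintegral_ofReal]
  · refine Integrable.of_integral_ne_zero ?_
    rw [h]
    positivity
  · refine (ae_restrict_iff' measurableSet_Ioi).mpr (Filter.Eventually.of_forall fun t ht => ?_)
    have : (0 : ℝ) < t := ht
    positivity

theorem lintegral_inv_sqrt_one_add_sum_sq_pow (m : ℕ) :
    ∫⁻ c : Fin m → ℝ, ENNReal.ofReal ((√(1 + ∑ i, c i ^ 2))⁻¹ ^ (m + 1)) =
      ENNReal.ofReal (√π ^ (m + 1) / Gamma (((m : ℝ) + 1) / 2)) := by
  set a : ℝ := ((m : ℝ) + 1) / 2 with ha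
  have ha0 : 0 < a := by positivity
  have hg := Gamma_pos_of_pos ha0
  have h1 (c : Fin m → ℝ) : ENNReal.ofReal ((√(1 + ∑ i, c i ^ 2))⁻¹ ^ (m + 1)) =
      ENNReal.ofReal (Gamma a)⁻¹ * ∫⁻ t in Ioi (0 : ℝ), ENNReal.ofReal (t ^ (a - 1) *
        rexp (-((1 + ∑ i, c i ^ 2) * t))) := by
    have hr : 0 < 1 + ∑ i, c i ^ 2 := by positivity
    rw [lintegral_rpow_mul_exp_neg_mul_Ioi ha0 hr, ← ENNReal.ofReal_mul (by positivity)]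
    congr 1
    rw [one_div, Real.sqrt_eq_rpow, ← Real.inv_rpow hr.le, ← Real.rpow_natCast,
      ← Real.rpow_mul (by positivity)]
    have : 1 / 2 * ((m + 1 : ℕ) : ℝ) = a := by rw [ha]; push_cast; ring
    rw [this]
    field_simp
  simp only [h1]
  rw [lintegral_const_mul' _ _ ENNReal.ofReal_ne_top, lintegral_lintegral_swap]
  · have h2 : ∀ t ∈ Ioi (0 : ℝ), ∫⁻ c : Fin m → ℝ, ENNReal.ofReal (t ^ (a - 1) *
        rexp (-((1 + ∑ i, c i ^ 2) * t))) = ENNReal.ofReal (√π ^ m) *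
          ENNReal.ofReal (t ^ ((1 / 2 : ℝ) - 1) * rexp (-(1 * t))) := by
      intro t (ht : 0 < t)
      have h3 (c : Fin m → ℝ) : ENNReal.ofReal (t ^ (a - 1) * rexp (-((1 + ∑ i, c i ^ 2) * t))) =
          ENNReal.ofReal (t ^ (a - 1) * rexp (-t)) *
            ENNReal.ofReal (rexp (-t * ∑ i, c i ^ 2)) := by
        rw [← ENNReal.ofReal_mul (by positivity), mul_assoc, ← Real.exp_add]
        congr 3
        ring
      simp only [h3]
      rw [lintegral_const_mul _ (by fun_prop), lintegral_exp_neg_mul_sum_sq _ ht,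
        ← ENNReal.ofReal_mul (by positivity), ← ENNReal.ofReal_mul (by positivity), Fintype.card_fin]
      congr 1
      have h4 : t ^ (a - 1) = t ^ ((1 / 2 : ℝ) - 1) * √t ^ m := by
        rw [Real.sqrt_eq_rpow, ← Real.rpow_natCast, ← Real.rpow_mul ht.le, ← Real.rpow_add ht]
        congr 1
        rw [ha]
        ring
      rw [h4, Real.sqrt_div Real.pi_pos.le, div_pow, one_mul]
      field_simp
    rw [setLIntegral_congr_fun measurableSet_Ioi h2, lintegral_const_mul' _ _ ENNReal.ofReal_ne_top,
      lintegral_rpow_mul_exp_neg_mul_Ioi (by norm_num) one_pos, Real.Gamma_one_half_eq,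
      ← ENNReal.ofReal_mul (by positivity), ← ENNReal.ofReal_mul (by positivity)]
    congr 1
    simp
    field_simp
    ring
  · refine Measurable.aemeasurable ?_
    unfold Function.uncurry
    fun_prop

/-- The Jacobian of the linear system `∑ i, w i • A i *ᵥ u = 0` with respect to the variable `t` on
which `w` depends (replacing the coordinate `j₀` of `u`) and to the other coordinates of `u`, is
the product of the coefficients with this matrix. -/
def jacobianMatrix {ι ρ : Type*} [DecidableEq ρ] (w w' : ι → ℝ) (u : ρ → ℝ) (j₀ : ρ) :
    Matrix (ι × ρ) ρ ℝ :=
  Matrix.of fun k c => if c = j₀ then w' k.1 * u k.2 else if k.2 = c then w k.1 else 0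

/-- The Gram matrix of the columns of `M` projected onto the orthogonal complement of `q`. -/
theorem gram_sub_projection {κ ρ : Type*} [Fintype κ] (M : Matrix κ ρ ℝ) (q : κ → ℝ)
    {Q : ℝ} (hQ : Q ≠ 0) (hQq : Q ^ 2 = ∑ k, q k ^ 2) (a b : ρ) :
    ((Matrix.of fun k c => M k c - q k / Q ^ 2 * ∑ l, q l * M l c).transpose *
      (Matrix.of fun k c => M k c - q k / Q ^ 2 * ∑ l, q l * M l c)) a b =
    ∑ k, M k a * M k b - (∑ k, q k * M k a) * (∑ k, q k * M k b) / Q ^ 2 := by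
  simp only [Matrix.mul_apply, Matrix.transpose_apply, Matrix.of_apply]
  generalize hα : ∑ l, q l * M l a = α
  generalize hβ : ∑ l, q l * M l b = β
  have : ∑ k, (M k a - q k / Q ^ 2 * α) * (M k b - q k / Q ^ 2 * β) =
      ∑ k, M k a * M k b - α / Q ^ 2 * (∑ k, q k * M k b) - β / Q ^ 2 * (∑ k, q k * M k a) +
        α * β / (Q ^ 2) ^ 2 * ∑ k, q k ^ 2 := by
    simp only [Finset.mul_sum, ← Finset.sum_sub_distrib, ← Finset.sum_add_distrib]
    refine Finset.sum_congr rfl fun k _ => ?_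
    ring
  rw [this, hα, hβ, ← hQq]
  field_simp
  ring

theorem det_gram_jacobianMatrix {ι : Type*} [Fintype ι] {m : ℕ} (w w' : ι → ℝ) (v : Fin m → ℝ)
    {W Q : ℝ} (hW : 0 < W) (hWw : W ^ 2 = ∑ i, w i ^ 2) (hQ : Q = W * √(1 + ∑ j, v j ^ 2)) :
    let M := jacobianMatrix w w' (Fin.cons 1 v : Fin (m + 1) → ℝ) 0
    let q : ι × Fin (m + 1) → ℝ := fun k => w k.1 * (Fin.cons 1 v : Fin (m + 1) → ℝ) k.2
    let N : Matrix (ι × Fin (m + 1)) (Fin (m + 1)) ℝ :=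
      Matrix.of fun k c => M k c - q k / Q ^ 2 * ∑ l, q l * M l c
    (N.transpose * N).det = (∑ i, w' i ^ 2 - (∑ i, w i * w' i) ^ 2 / W ^ 2) * (W ^ 2) ^ m := by
  intro M q N
  set U : ℝ := 1 + ∑ j, v j ^ 2 with hU
  have hUpos : 0 < U := by positivity
  have hQ2 : Q ^ 2 = W ^ 2 * U := by rw [hQ, mul_pow, Real.sq_sqrt hUpos.le]
  have hQ0 : Q ≠ 0 := by rw [hQ]; positivity
  have hu : ∑ c, (Fin.cons 1 v : Fin (m + 1) → ℝ) c ^ 2 = U := by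
    rw [Fin.sum_univ_succ]; simp [hU]
  have hQq : Q ^ 2 = ∑ k, q k ^ 2 := by
    simp only [q, mul_pow, Fintype.sum_prod_type, ← Finset.mul_sum, hu, ← Finset.sum_mul, ← hWw, hQ2]
  have hS := gram_sub_projection M q hQ0 hQq
  change ∀ a b, (N.transpose * N) a b = _ at hS
  set B := ∑ i, w i * w' i with hB
  have hq0 : ∑ k, q k * M k 0 = B * U := by
    simp only [q, M, jacobianMatrix, Matrix.of_apply, if_true, Fintype.sum_prod_type]
    rw [← hu, hB, Finset.sum_mul_sum]
    refine Finset.sum_congr rfl fun i _ => Finset.sum_congr rfl fun c _ => ?_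
    ring
  have hqs (j : Fin m) : ∑ k, q k * M k j.succ = W ^ 2 * v j := by
    simp only [q, M, jacobianMatrix, Matrix.of_apply, Fin.succ_ne_zero, if_false,
      Fintype.sum_prod_type, mul_ite, mul_zero, Finset.sum_ite_eq', Finset.mem_univ, if_true,
      Fin.cons_succ]
    rw [hWw, Finset.sum_mul]
    refine Finset.sum_congr rfl fun i _ => ?_
    ring
  have h00 : ∑ k, M k 0 * M k 0 = (∑ i, w' i ^ 2) * U := by
    simp only [M, jacobianMatrix, Matrix.of_apply, if_true, Fintype.sum_prod_type]
    rw [← hu, Finset.sum_mul_sum]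
    refine Finset.sum_congr rfl fun i _ => Finset.sum_congr rfl fun c _ => ?_
    ring
  have h0s (j : Fin m) : ∑ k, M k 0 * M k j.succ = B * v j := by
    simp only [M, jacobianMatrix, Matrix.of_apply, Fin.succ_ne_zero, if_false, if_true,
      Fintype.sum_prod_type, mul_ite, mul_zero, Finset.sum_ite_eq', Finset.mem_univ, Fin.cons_succ]
    rw [hB, Finset.sum_mul]
    refine Finset.sum_congr rfl fun i _ => ?_
    ring
  have hss (i j : Fin m) : ∑ k, M k i.succ * M k j.succ = if i = j then W ^ 2 else 0 := by
    simp only [M, jacobianMatrix, Matrix.of_apply, Fin.succ_ne_zero, if_false,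
      Fintype.sum_prod_type, mul_ite, mul_zero, Finset.sum_ite_eq', Finset.mem_univ, if_true,
      Fin.succ_inj, ite_mul, zero_mul]
    split_ifs with h h' h'
    · rw [hWw]; exact Finset.sum_congr rfl fun i _ => (sq _).symm
    · exact (h' h.symm).elim
    · exact (h h'.symm).elim
    · simp
  rw [Matrix.det_succ_row_zero, Fin.sum_univ_succ]
  have hz (j : Fin m) : (N.transpose * N) 0 j.succ = 0 := by
    rw [hS, h0s, hq0, hqs, hQ2]
    field_simp
    ring
  simp only [hz, mul_zero, zero_mul, Finset.sum_const_zero, add_zero, Fin.val_zero, pow_zero,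
    one_mul]
  have hsub : (N.transpose * N).submatrix Fin.succ (Fin.succAbove 0) =
      W ^ 2 • (1 - Matrix.replicateCol Unit v * Matrix.replicateRow Unit (U⁻¹ • v)) := by
    ext i j
    rw [Matrix.submatrix_apply, Fin.zero_succAbove, hS, hss, hqs, hqs, hQ2]
    simp [Matrix.one_apply, Matrix.mul_apply]
    split_ifs
    · field_simp
    · field_simp
      ring
  rw [hsub, Matrix.det_smul, Matrix.det_one_sub_mul_comm, hS, h00, hq0, hQ2]
  have h1 : (1 - Matrix.replicateRow Unit (U⁻¹ • v) * Matrix.replicateCol Unit v).det = U⁻¹ := by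
    rw [Matrix.det_unique]
    simp [Matrix.mul_apply]
    have : ∑ x, v x * v x = U - 1 := by
      rw [hU, add_sub_cancel_left]
      exact Finset.sum_congr rfl fun i _ => (sq _).symm
    rw [this]
    field_simp
    ring
  rw [h1, Fintype.card_fin]
  field_simp

theorem LinearMap.det_of_fst_eq {E F : Type*} [AddCommGroup E] [Module ℝ E] [Module.Finite ℝ E]
    [AddCommGroup F] [Module ℝ F] [Module.Finite ℝ F] (T : E × F →ₗ[ℝ] E × F)
    (hT : ∀ x, (T x).1 = x.1) :
    LinearMap.det T = LinearMap.det ((LinearMap.snd ℝ E F ∘ₗ T) ∘ₗ LinearMap.inr ℝ E F) := by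
  classical
  set b := Module.finBasis ℝ E
  set b' := Module.finBasis ℝ F
  rw [← LinearMap.det_toMatrix (b.prod b'), ← LinearMap.det_toMatrix b',
    ← Matrix.fromBlocks_toBlocks (LinearMap.toMatrix (b.prod b') (b.prod b') T)]
  have h₁ : (LinearMap.toMatrix (b.prod b') (b.prod b') T).toBlocks₁₁ = 1 := by
    ext i j
    simp [Matrix.toBlocks₁₁, LinearMap.toMatrix_apply, hT, Matrix.one_apply,
      Finsupp.single_apply, eq_comm]
  have h₂ : (LinearMap.toMatrix (b.prod b') (b.prod b') T).toBlocks₁₂ = 0 := by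
    ext i j
    simp [Matrix.toBlocks₁₂, LinearMap.toMatrix_apply, hT]
  rw [h₁, h₂, Matrix.det_fromBlocks_zero₁₂, Matrix.det_one, one_mul]
  congr 1
  ext i j
  simp [Matrix.toBlocks₂₂, LinearMap.toMatrix_apply]

/-- The vector `f t ⊗ u`, where `t` is the coordinate `j` of `τ` and `u` is obtained from `τ` by
normalizing this coordinate to `1`. -/
def kernelWeight {ι ρ : Type*} [DecidableEq ρ] (f : ι → ℝ → ℝ) (j : ρ) (τ : ρ → ℝ) : ι × ρ → ℝ :=
  fun k => f k.1 (τ j) * Function.update τ j 1 k.2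

/-- The solution `x` of `∑ k ≠ k₀, q k • z k + q k₀ • x = 0`. -/
noncomputable def solveEntry {κ ρ : Type*} [Fintype κ] [DecidableEq κ] (q : κ → ℝ) (k₀ : κ)
    (z : {k // k ≠ k₀} → ρ → ℝ) : ρ → ℝ :=
  fun r => -((q k₀)⁻¹ * ∑ k : {k // k ≠ k₀}, q k * z k r)

/-- The family with entry `x` at `k₀` and entries `z` elsewhere. -/
def extendEntry {κ ρ : Type*} [DecidableEq κ] (k₀ : κ) (z : {k // k ≠ k₀} → ρ → ℝ) (x : ρ → ℝ) :
    κ → ρ → ℝ :=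
  fun k r => if h : k = k₀ then x r else z ⟨k, h⟩ r

theorem hasFDerivAt_kernelWeight {ι ρ : Type*} [Fintype ρ] [DecidableEq ρ]
    {f : ι → ℝ → ℝ} (hf : ∀ i, Differentiable ℝ (f i)) (j : ρ)
    (τ : ρ → ℝ) (k : ι × ρ) :
    HasFDerivAt (fun τ => kernelWeight f j τ k)
      (∑ c, jacobianMatrix (fun i => f i (τ j)) (fun i => deriv (f i) (τ j))
        (Function.update τ j 1) j k c • (ContinuousLinearMap.proj c : (ρ → ℝ) →L[ℝ] ℝ)) τ := by
  have h₁ : HasFDerivAt (fun τ : ρ → ℝ => f k.1 (τ j))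
      (deriv (f k.1) (τ j) • (ContinuousLinearMap.proj j : (ρ → ℝ) →L[ℝ] ℝ)) τ :=
    (hf k.1 (τ j)).hasDerivAt.comp_hasFDerivAt τ (hasFDerivAt_apply j τ)
  by_cases hk : k.2 = j
  · have : (fun τ : ρ → ℝ => kernelWeight f j τ k) = fun τ => f k.1 (τ j) := by
      ext τ; simp [kernelWeight, hk]
    rw [this]
    refine h₁.congr_fderiv ?_
    ext x
    rw [_root_.sum_apply, Finset.sum_eq_single j]
    · simp [jacobianMatrix, hk]
    · intro c _ hc
      simp [jacobianMatrix, hc, hk, Ne.symm hc]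
    · simp
  · have : (fun τ : ρ → ℝ => kernelWeight f j τ k) = fun τ => f k.1 (τ j) * τ k.2 := by
      ext τ; simp [kernelWeight, hk]
    rw [this]
    refine (h₁.mul (hasFDerivAt_apply k.2 τ)).congr_fderiv ?_
    ext x
    rw [_root_.sum_apply, Finset.sum_eq_add j k.2 (Ne.symm hk)]
    · simp [jacobianMatrix, hk]
      ring
    · intro c _ hc
      simp [jacobianMatrix, hc.1, hc.2.symm]
    · simp
    · simp

/-- The derivative of `(z, τ) ↦ (z, solveEntry (q τ) k₀ z)`, where `M` is the Jacobian matrix of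
`q`. -/
noncomputable def solveEntryDeriv {κ ρ : Type*} [Fintype ρ] [Fintype κ] [DecidableEq κ] (q : κ → ℝ)
    (M : Matrix κ ρ ℝ) (k₀ : κ) (z : {k // k ≠ k₀} → ρ → ℝ) :
    (({k // k ≠ k₀} → ρ → ℝ) × (ρ → ℝ)) →L[ℝ] (({k // k ≠ k₀} → ρ → ℝ) × (ρ → ℝ)) :=
  (ContinuousLinearMap.fst ℝ _ _).prod <| ContinuousLinearMap.pi fun r =>
    -((q k₀)⁻¹ • ((∑ k : {k // k ≠ k₀}, q k • ((ContinuousLinearMap.proj r).comp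
      (ContinuousLinearMap.proj (R := ℝ) (φ := fun _ : {k // k ≠ k₀} => ρ → ℝ) k)).comp
        (ContinuousLinearMap.fst ℝ _ _)) +
      ∑ c, (∑ k, M k c * extendEntry k₀ z (solveEntry q k₀ z) k r) •
        (ContinuousLinearMap.proj c).comp (ContinuousLinearMap.snd ℝ _ _)))

theorem solveEntryDeriv_apply {κ ρ : Type*} [Fintype ρ] [Fintype κ] [DecidableEq κ] (q : κ → ℝ)
    (M : Matrix κ ρ ℝ) (k₀ : κ) (z : {k // k ≠ k₀} → ρ → ℝ)
    (x : ({k // k ≠ k₀} → ρ → ℝ) × (ρ → ℝ)) :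
    solveEntryDeriv q M k₀ z x = (x.1, fun r => -((q k₀)⁻¹ *
      (∑ k : {k // k ≠ k₀}, q k * x.1 k r +
        ∑ c, (∑ k, M k c * extendEntry k₀ z (solveEntry q k₀ z) k r) * x.2 c))) := by
  ext : 1
  · rfl
  · ext r
    simp [solveEntryDeriv]
    ring

theorem det_solveEntryDeriv {κ ρ : Type*} [Fintype ρ] [DecidableEq ρ] [Fintype κ] [DecidableEq κ] (q : κ → ℝ)
    (M : Matrix κ ρ ℝ) (k₀ : κ) (z : {k // k ≠ k₀} → ρ → ℝ) :
    (solveEntryDeriv q M k₀ z).det = (-(q k₀)⁻¹) ^ Fintype.card ρ *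
      (Matrix.of fun r c => ∑ k, M k c * extendEntry k₀ z (solveEntry q k₀ z) k r).det := by
  rw [ContinuousLinearMap.det, LinearMap.det_of_fst_eq _ fun x => rfl, ← Matrix.det_smul,
    ← LinearMap.det_toLin']
  congr 1
  ext i r
  simp only [LinearMap.comp_apply, LinearMap.snd_apply, LinearMap.inr_apply,
    ContinuousLinearMap.coe_coe, solveEntryDeriv_apply, Matrix.toLin'_apply, Matrix.mulVec,
    dotProduct]
  simp only [Finset.mul_sum, Finset.sum_mul, mul_assoc, smul_eq_mul, Matrix.smul_apply,
    Matrix.of_apply]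
  simp only [← Finset.mul_sum, Pi.zero_apply, mul_zero, Finset.sum_const_zero, zero_add]
  ring

theorem sum_eq_add_sum_subtype_ne {κ : Type*} [Fintype κ] [DecidableEq κ] (k₀ : κ) (g : κ → ℝ) :
    ∑ k, g k = g k₀ + ∑ k : {k // k ≠ k₀}, g k := by
  rw [← Finset.add_sum_erase _ _ (Finset.mem_univ k₀)]
  congr 1
  exact Finset.sum_subtype _ (by simp) _

theorem sum_mul_extendEntry {κ ρ : Type*} [Fintype κ] [DecidableEq κ] (k₀ : κ) (g : κ → ℝ)
    (z : {k // k ≠ k₀} → ρ → ℝ) (x : ρ → ℝ) (r : ρ) :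
    ∑ k, g k * extendEntry k₀ z x k r = g k₀ * x r + ∑ k : {k // k ≠ k₀}, g k * z k r := by
  rw [sum_eq_add_sum_subtype_ne k₀]
  congr 1
  · simp [extendEntry]
  · refine Finset.sum_congr rfl fun k _ => ?_
    simp [extendEntry, k.2]

theorem hasFDerivAt_solveEntry {ι ρ : Type*} [Fintype ι] [DecidableEq ι] [Fintype ρ]
    [DecidableEq ρ] {f : ι → ℝ → ℝ} (hf : ∀ i, Differentiable ℝ (f i)) (k₀ : ι × ρ)
    (x : ({k // k ≠ k₀} → ρ → ℝ) × (ρ → ℝ)) (h₀ : f k₀.1 (x.2 k₀.2) ≠ 0) :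
    HasFDerivAt (fun x : ({k // k ≠ k₀} → ρ → ℝ) × (ρ → ℝ) =>
        (x.1, solveEntry (kernelWeight f k₀.2 x.2) k₀ x.1))
      (solveEntryDeriv (kernelWeight f k₀.2 x.2)
        (jacobianMatrix (fun i => f i (x.2 k₀.2)) (fun i => deriv (f i) (x.2 k₀.2))
          (Function.update x.2 k₀.2 1) k₀.2) k₀ x.1) x := by
  have hq₀ : kernelWeight f k₀.2 x.2 k₀ ≠ 0 := by simpa [kernelWeight] using h₀
  refine hasFDerivAt_fst.prodMk (hasFDerivAt_pi.2 fun r => ?_)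
  have hq (k : ι × ρ) := (hasFDerivAt_kernelWeight hf k₀.2 x.2 k).comp x hasFDerivAt_snd
  have hz (k : {k // k ≠ k₀}) := (((ContinuousLinearMap.proj (R := ℝ) (φ := fun _ : ρ => ℝ) r).comp
    (ContinuousLinearMap.proj (R := ℝ) (φ := fun _ : {k // k ≠ k₀} => ρ → ℝ) k)).comp
      (ContinuousLinearMap.fst ℝ _ (ρ → ℝ))).hasFDerivAt (x := x)
  have hinv := (hasDerivAt_inv hq₀).comp_hasFDerivAt x (hq k₀)
  have hsum := HasFDerivAt.fun_sum (u := Finset.univ)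
    fun (k : {k // k ≠ k₀}) _ => (hq k).mul (hz k)
  refine (hinv.mul hsum).neg.congr_fderiv ?_
  refine ContinuousLinearMap.ext fun y => ?_
  simp only [ContinuousLinearMap.coe_comp, Function.comp_apply, ContinuousLinearMap.proj_apply]
  simp only [neg_apply, add_apply, smul_apply, _root_.sum_apply, ContinuousLinearMap.coe_comp,
    Function.comp_apply, ContinuousLinearMap.proj_apply,
    ContinuousLinearMap.coe_snd', ContinuousLinearMap.coe_fst', smul_eq_mul]
  generalize jacobianMatrix (fun i => f i (x.2 k₀.2)) (fun i => deriv (f i) (x.2 k₀.2))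
    (Function.update x.2 k₀.2 1) k₀.2 = M
  have hcomm (E : ι × ρ → ℝ) : ∑ c, (∑ k, M k c * E k) * y.2 c = ∑ k, (∑ c, M k c * y.2 c) * E k := by
    simp only [Finset.sum_mul]
    rw [Finset.sum_comm]
    exact Finset.sum_congr rfl fun k _ => Finset.sum_congr rfl fun c _ => by ring
  rw [hcomm, sum_mul_extendEntry]
  generalize (fun k => ∑ c, M k c * y.2 c) = D
  simp only [Pi.mul_apply, Function.comp_apply, ContinuousLinearMap.proj_apply, solveEntry]
  generalize kernelWeight f k₀.2 x.2 = q at hq₀ ⊢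
  rw [Finset.sum_add_distrib]
  simp only [mul_comm (x.1 _ _)]
  field_simp
  ring

theorem norm_deriv_normalize {E : Type*} [NormedAddCommGroup E] [InnerProductSpace ℝ E]
    {v : ℝ → E} {v' : E} {t : ℝ} (hv : HasDerivAt v v' t) (h₀ : v t ≠ 0) :
    ‖deriv (fun t => ‖v t‖⁻¹ • v t) t‖ =
      √(‖v'‖ ^ 2 - inner ℝ (v t) v' ^ 2 / ‖v t‖ ^ 2) / ‖v t‖ := by
  have hpos : 0 < ‖v t‖ := norm_pos_iff.2 h₀
  have hnorm : HasDerivAt (fun t => ‖v t‖) (inner ℝ (v t) v' / ‖v t‖) t := by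
    have := hv.norm_sq.sqrt (by positivity)
    simp only [Real.sqrt_sq (norm_nonneg _)] at this
    refine this.congr_deriv ?_
    field_simp
  rw [((hnorm.fun_inv hpos.ne').fun_smul hv).deriv, eq_div_iff hpos.ne',
    ← Real.sqrt_sq (mul_nonneg (norm_nonneg _) hpos.le), mul_pow]
  congr 1
  rw [@norm_add_sq_real, norm_smul, norm_smul, real_inner_smul_left, real_inner_smul_right,
    real_inner_comm]
  simp only [mul_pow, Real.norm_eq_abs, sq_abs]
  field_simp
  ring

theorem sum_extendEntry {κ ρ R : Type*} [Fintype κ] [DecidableEq κ] [AddCommMonoid R] (k₀ : κ)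
    (z : {k // k ≠ k₀} → ρ → ℝ) (x : ρ → ℝ) (g : κ → (ρ → ℝ) → R) :
    ∑ k, g k (extendEntry k₀ z x k) = ∑ k : {k // k ≠ k₀}, g k (z k) + g k₀ x := by
  rw [← Finset.sum_erase_add _ _ (Finset.mem_univ k₀)]
  congr 1
  · rw [Finset.sum_subtype _ (p := (· ≠ k₀)) (by simp)]
    refine Finset.sum_congr rfl fun k _ => ?_
    congr 1
    ext r
    simp [extendEntry, k.2]
  · congr 1
    ext r
    simp [extendEntry]

theorem measurable_extendEntry {κ ρ : Type*} [DecidableEq κ] (k₀ : κ) :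
    Measurable fun x : ({k // k ≠ k₀} → ρ → ℝ) × (ρ → ℝ) => extendEntry k₀ x.1 x.2 := by
  refine measurable_pi_lambda _ fun k => measurable_pi_lambda _ fun r => ?_
  by_cases h : k = k₀
  · simp only [extendEntry, h, dite_true]
    fun_prop
  · simp only [extendEntry, h, dite_false]
    fun_prop

theorem measurePreserving_extendEntry {κ ρ : Type*} [Fintype κ] [DecidableEq κ] [Fintype ρ]
    (k₀ : κ) :
    MeasurePreserving (fun x : ({k // k ≠ k₀} → ρ → ℝ) × (ρ → ℝ) => extendEntry k₀ x.1 x.2) := by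
  refine ⟨measurable_extendEntry k₀, ?_⟩
  refine (Measure.pi_eq fun s hs => ?_).symm
  rw [Measure.map_apply (measurable_extendEntry k₀) (.univ_pi hs)]
  have : (fun x : ({k // k ≠ k₀} → ρ → ℝ) × (ρ → ℝ) => extendEntry k₀ x.1 x.2) ⁻¹' pi univ s =
      (pi univ fun k : {k // k ≠ k₀} => s k) ×ˢ s k₀ := by
    ext x
    simp only [mem_preimage, mem_pi, mem_univ, true_imp_iff, mem_prod]
    have h₀ : extendEntry k₀ x.1 x.2 k₀ = x.2 := by ext r; simp [extendEntry]
    have h₁ (k : {k // k ≠ k₀}) : extendEntry k₀ x.1 x.2 k = x.1 k := by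
      ext r; simp [extendEntry, k.2]
    refine ⟨fun h => ⟨fun k => h₁ k ▸ h k, h₀ ▸ h k₀⟩, fun h k => ?_⟩
    by_cases hk : k = k₀
    · subst hk; rw [h₀]; exact h.2
    · rw [h₁ ⟨k, hk⟩]; exact h.1 ⟨k, hk⟩
  rw [this, Measure.volume_eq_prod, Measure.prod_prod, volume_pi_pi,
    ← Finset.prod_erase_mul _ _ (Finset.mem_univ k₀)]
  congr 1
  exact (Finset.prod_subtype (p := (· ≠ k₀)) _ (by simp) fun k => volume (s k)).symm

theorem lintegral_hyperplane_extendEntry {κ ρ : Type*} [Fintype κ] [DecidableEq κ] [Fintype ρ]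
    (q : κ → ℝ) {k₀ : κ} (hq₀ : q k₀ ≠ 0) {Q : ℝ} (hQ : 0 < Q) (hQq : Q ^ 2 = ∑ k, q k ^ 2)
    {F : (κ → ρ → ℝ) → ℝ≥0∞} (hF : Measurable F) :
    ∫⁻ z : {k // k ≠ k₀} → ρ → ℝ, F (extendEntry k₀ z (solveEntry q k₀ z)) *
        ENNReal.ofReal (rexp (-(∑ k, ∑ r, extendEntry k₀ z (solveEntry q k₀ z) k r ^ 2) / 2)) =
      ENNReal.ofReal ((|q k₀| / (√(2 * π) * Q)) ^ Fintype.card ρ) *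
        ∫⁻ A : κ → ρ → ℝ, F (fun k r => A k r - q k / Q ^ 2 * ∑ l, q l * A l r) *
          ENNReal.ofReal (rexp (-(∑ k, ∑ r, A k r ^ 2) / 2)) := by
  have h := lintegral_hyperplane (ρ := ρ) (fun k : {k // k ≠ k₀} => q k) hq₀ hQ
    (by rw [hQq, sum_eq_add_sum_subtype_ne k₀, add_comm])
    (F := fun x => F (extendEntry k₀ x.1 x.2)) (hF.comp (measurable_extendEntry k₀))
  have hL (z : {k // k ≠ k₀} → ρ → ℝ) :
      ∑ k, ∑ r, extendEntry k₀ z (solveEntry q k₀ z) k r ^ 2 =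
      ∑ k, ∑ r, z k r ^ 2 + ∑ r, ((q k₀)⁻¹ * ∑ k : {k // k ≠ k₀}, q k * z k r) ^ 2 := by
    rw [sum_extendEntry k₀ z _ fun _ x => ∑ r, x r ^ 2]
    simp [solveEntry]
  simp only [hL]
  refine h.trans ?_
  congr 1
  rw [← (measurePreserving_extendEntry k₀).lintegral_comp]
  · refine lintegral_congr fun x => ?_
    rw [sum_extendEntry k₀ x.1 x.2 fun _ x => ∑ r, x r ^ 2]
    congr 2
    have hs (r : ρ) : ∑ l, q l * extendEntry k₀ x.1 x.2 l r =
        ∑ l : {k // k ≠ k₀}, q l * x.1 l r + q k₀ * x.2 r := by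
      rw [sum_extendEntry k₀ x.1 x.2 fun l x => q l * x r]
    ext k r
    rw [hs]
    by_cases hk : k = k₀
    · simp [extendEntry, hk]
    · simp [extendEntry, hk]
  · exact (hF.comp (by fun_prop)).mul (by fun_prop)

theorem lintegral_abs_det_solveEntryDeriv {κ ρ : Type*} [Fintype κ] [DecidableEq κ] [Fintype ρ]
    [DecidableEq ρ] (q : κ → ℝ) (M : Matrix κ ρ ℝ) {k₀ : κ} (hq₀ : q k₀ ≠ 0) {Q : ℝ} (hQ : 0 < Q)
    (hQq : Q ^ 2 = ∑ k, q k ^ 2) :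
    let N : Matrix κ ρ ℝ := Matrix.of fun k c => M k c - q k / Q ^ 2 * ∑ l, q l * M l c
    ∫⁻ z : {k // k ≠ k₀} → ρ → ℝ, ENNReal.ofReal |(solveEntryDeriv q M k₀ z).det| *
        ENNReal.ofReal ((√(2 * π))⁻¹ ^ (Fintype.card κ * Fintype.card ρ) *
          rexp (-(∑ k, ∑ r, extendEntry k₀ z (solveEntry q k₀ z) k r ^ 2) / 2)) =
      ENNReal.ofReal ((√(2 * π) * Q)⁻¹ ^ Fintype.card ρ) *
        (ENNReal.ofReal √(N.transpose * N).det * gaussianAbsDet ρ) := by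
  intro N
  set C : ℝ≥0∞ := ENNReal.ofReal ((√(2 * π))⁻¹ ^ (Fintype.card κ * Fintype.card ρ)) with hC
  set G : (κ → ρ → ℝ) → ℝ≥0∞ := fun A =>
    ENNReal.ofReal |(Matrix.of fun r c => ∑ k, M k c * A k r).det| with hG
  have hGm : Measurable G := by
    refine (measurable_ofReal_abs_det (ρ := ρ)).comp ?_
    fun_prop
  have h1 (z : {k // k ≠ k₀} → ρ → ℝ) : ENNReal.ofReal |(solveEntryDeriv q M k₀ z).det| *
        ENNReal.ofReal ((√(2 * π))⁻¹ ^ (Fintype.card κ * Fintype.card ρ) *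
          rexp (-(∑ k, ∑ r, extendEntry k₀ z (solveEntry q k₀ z) k r ^ 2) / 2)) =
      C * ENNReal.ofReal (|q k₀|⁻¹ ^ Fintype.card ρ) *
        (G (extendEntry k₀ z (solveEntry q k₀ z)) * ENNReal.ofReal
          (rexp (-(∑ k, ∑ r, extendEntry k₀ z (solveEntry q k₀ z) k r ^ 2) / 2))) := by
    rw [det_solveEntryDeriv, abs_mul, abs_pow, abs_neg, abs_inv,
      ENNReal.ofReal_mul (by positivity), ENNReal.ofReal_mul (by positivity)]
    ring
  simp only [h1]
  have hCt : C ≠ ⊤ := ENNReal.ofReal_ne_top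
  rw [lintegral_const_mul' _ _ (by finiteness), lintegral_hyperplane_extendEntry q hq₀ hQ hQq hGm]
  have h2 : C * ∫⁻ A : κ → ρ → ℝ, G (fun k r => A k r - q k / Q ^ 2 * ∑ l, q l * A l r) *
          ENNReal.ofReal (rexp (-(∑ k, ∑ r, A k r ^ 2) / 2)) =
      ENNReal.ofReal √(N.transpose * N).det * gaussianAbsDet ρ := by
    have hm : Measurable fun A : ρ → κ → ℝ => ENNReal.ofReal |(Matrix.of A * N).det| := by
      refine (measurable_ofReal_abs_det (ρ := ρ)).comp (g := fun G : ρ → ρ → ℝ => ENNReal.ofReal |(Matrix.of G).det|)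
        (f := fun (A : ρ → κ → ℝ) (r c : ρ) => ∑ k, A r k * N k c) ?_
      fun_prop
    have hm' : Measurable fun A : κ → ρ → ℝ =>
        ENNReal.ofReal |(Matrix.of (fun r k => A k r) * N).det| :=
      hm.comp (measurePreserving_flip (gaussianReal 0 1)).measurable
    rw [← lintegral_abs_det_gaussian_mul, ← (measurePreserving_flip (gaussianReal 0 1)).lintegral_comp
      hm, pi_pi_gaussianReal_eq_withDensity,
      lintegral_withDensity_eq_lintegral_mul _ (by fun_prop) hm',
      ← lintegral_const_mul' _ _ hCt]
    refine lintegral_congr fun A => ?_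
    rw [Pi.mul_apply, ENNReal.ofReal_mul (by positivity), ← hC, mul_assoc, mul_comm (G _)]
    congr 3
    simp only [G]
    congr 3
    ext r c
    simp only [N, Matrix.of_apply, Matrix.mul_apply, mul_sub, Finset.sum_sub_distrib]
    congr 1
    · exact Finset.sum_congr rfl fun k _ => mul_comm _ _
    · simp only [Finset.mul_sum]
      rw [Finset.sum_comm]
      refine Finset.sum_congr rfl fun k _ => Finset.sum_congr rfl fun l _ => ?_
      ring
  rw [← h2]
  have h3 : (√(2 * π) * Q)⁻¹ ^ Fintype.card ρ =
      |q k₀|⁻¹ ^ Fintype.card ρ * (|q k₀| / (√(2 * π) * Q)) ^ Fintype.card ρ := by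
    have := abs_pos.2 hq₀
    rw [← mul_pow]
    congr 1
    field_simp
  rw [h3, ENNReal.ofReal_mul (by positivity)]
  ring

/-- The equivalence between families and pairs of a family indexed by `k ≠ k₀` and an entry. -/
def extendEntryEquiv {κ : Type*} (ρ : Type*) [DecidableEq κ] (k₀ : κ) :
    (({k // k ≠ k₀} → ρ → ℝ) × (ρ → ℝ)) ≃ᵐ (κ → ρ → ℝ) where
  toFun x := extendEntry k₀ x.1 x.2
  invFun A := (fun k => A k, A k₀)
  left_inv x := by
    ext k r
    · simp [extendEntry, k.2]
    · simp [extendEntry]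
  right_inv A := by
    ext k r
    by_cases h : k = k₀
    · simp [extendEntry, h]
    · simp [extendEntry, h]
  measurable_toFun := measurable_extendEntry k₀
  measurable_invFun := by
    change Measurable fun A : κ → ρ → ℝ => (fun k : {k // k ≠ k₀} => A k, A k₀)
    fun_prop

theorem sum_mul_extendEntry_eq_zero_iff {κ ρ : Type*} [Fintype κ] [DecidableEq κ] {q : κ → ℝ}
    {k₀ : κ} (hq₀ : q k₀ ≠ 0) (z : {k // k ≠ k₀} → ρ → ℝ) (x : ρ → ℝ) :
    (∀ r, ∑ k, q k * extendEntry k₀ z x k r = 0) ↔ solveEntry q k₀ z = x := by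
  simp only [sum_mul_extendEntry, funext_iff, solveEntry]
  refine forall_congr' fun r => ?_
  generalize ∑ k : {k // k ≠ k₀}, q k * z k r = S
  constructor
  · intro h
    field_simp
    linarith
  · rintro h
    rw [← h]
    field_simp
    ring

theorem measurable_update_one {ρ : Type*} [DecidableEq ρ] (j c : ρ) :
    Measurable fun τ : ρ → ℝ => Function.update τ j 1 c := by
  by_cases h : c = j
  · subst h; simp
  · simp only [Function.update_of_ne h]; fun_prop

theorem measurable_kernelWeight {ι ρ : Type*} [DecidableEq ρ] {f : ι → ℝ → ℝ}
    (hf : ∀ i, Differentiable ℝ (f i)) (j : ρ) : Measurable (kernelWeight f j) := by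
  have := fun i => (hf i).continuous.measurable
  have := measurable_update_one (ρ := ρ) j
  unfold kernelWeight
  fun_prop

theorem measurable_solveEntry_kernelWeight {ι ρ : Type*} [Fintype ι] [DecidableEq ι] [Fintype ρ] [DecidableEq ρ]
    {f : ι → ℝ → ℝ} (hf : ∀ i, Differentiable ℝ (f i)) (k₀ : ι × ρ) :
    Measurable fun x : ({k // k ≠ k₀} → ρ → ℝ) × (ρ → ℝ) =>
      (x.1, solveEntry (kernelWeight f k₀.2 x.2) k₀ x.1) := by
  have := measurable_kernelWeight hf k₀.2
  unfold solveEntry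
  fun_prop

theorem measurable_jacobianMatrix {ι ρ : Type*} [DecidableEq ρ] {f : ι → ℝ → ℝ}
    (hf : ∀ i, Differentiable ℝ (f i)) (j : ρ) (k : ι × ρ) (c : ρ) :
    Measurable fun τ : ρ → ℝ => jacobianMatrix (fun i => f i (τ j)) (fun i => deriv (f i) (τ j))
        (Function.update τ j 1) j k c := by
  have h1 := fun i => (hf i).continuous.measurable
  have h2 := measurable_update_one (ρ := ρ) j
  have h3 := fun i => measurable_deriv (f i)
  by_cases hc : c = j
  · simp only [jacobianMatrix, Matrix.of_apply, if_pos hc]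
    exact ((h3 _).comp (measurable_pi_apply j)).mul (h2 _)
  · simp only [jacobianMatrix, Matrix.of_apply, if_neg hc]
    split_ifs <;> fun_prop

theorem measurable_det_solveEntryDeriv {ι ρ : Type*} [Fintype ι] [DecidableEq ι] [Fintype ρ] [DecidableEq ρ]
    {f : ι → ℝ → ℝ} (hf : ∀ i, Differentiable ℝ (f i)) (k₀ : ι × ρ) :
    Measurable fun x : ({k // k ≠ k₀} → ρ → ℝ) × (ρ → ℝ) =>
      (solveEntryDeriv (kernelWeight f k₀.2 x.2)
        (jacobianMatrix (fun i => f i (x.2 k₀.2)) (fun i => deriv (f i) (x.2 k₀.2))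
          (Function.update x.2 k₀.2 1) k₀.2) k₀ x.1).det := by
  have h1 := measurable_kernelWeight hf k₀.2
  have h2 (k : ι × ρ) (c : ρ) := (measurable_jacobianMatrix hf k₀.2 k c).comp
    (measurable_snd : Measurable fun x : ({k // k ≠ k₀} → ρ → ℝ) × (ρ → ℝ) => x.2)
  have h3 (k : ι × ρ) (r : ρ) := ((measurable_pi_apply r).comp (measurable_pi_apply k)).comp
    ((measurable_extendEntry k₀).comp (measurable_solveEntry_kernelWeight hf k₀))
  simp only [Function.comp_def] at h2 h3
  simp only [det_solveEntryDeriv, Matrix.det_apply, Matrix.of_apply]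
  fun_prop

theorem isAddHaarMeasure_volume_pi_prod (κ ρ : Type*) [Fintype κ] [Fintype ρ] :
    (volume : Measure ((κ → ρ → ℝ) × (ρ → ℝ))).IsAddHaarMeasure := by
  have : (Measure.pi fun _ : κ => (volume : Measure (ρ → ℝ))).IsAddHaarMeasure :=
    Measure.pi.isAddHaarMeasure _
  exact Measure.prod.instIsAddHaarMeasure (Measure.pi fun _ : κ => (volume : Measure (ρ → ℝ)))
    (volume : Measure (ρ → ℝ))

theorem lintegral_encard_kernel {ι ρ : Type*} [Fintype ι] [DecidableEq ι] [Fintype ρ] [DecidableEq ρ]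
    {f : ι → ℝ → ℝ} (hf : ∀ i, Differentiable ℝ (f i)) (k₀ : ι × ρ) {T : Set ℝ}
    (hT : MeasurableSet T) (h₀ : ∀ t ∈ T, f k₀.1 t ≠ 0) :
    AEMeasurable (fun B : ι × ρ → ρ → ℝ => ({τ : ρ → ℝ | τ k₀.2 ∈ T ∧
        ∀ r, ∑ k, kernelWeight f k₀.2 τ k * B k r = 0}.encard : ℝ≥0∞))
      (Measure.pi fun _ => Measure.pi fun _ => gaussianReal 0 1) ∧
    ∫⁻ B : ι × ρ → ρ → ℝ, ({τ : ρ → ℝ | τ k₀.2 ∈ T ∧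
        ∀ r, ∑ k, kernelWeight f k₀.2 τ k * B k r = 0}.encard : ℝ≥0∞)
      ∂(Measure.pi fun _ => Measure.pi fun _ => gaussianReal 0 1) =
    ∫⁻ τ in {τ : ρ → ℝ | τ k₀.2 ∈ T}, ∫⁻ z : {k // k ≠ k₀} → ρ → ℝ,
      ENNReal.ofReal |(solveEntryDeriv (kernelWeight f k₀.2 τ)
        (jacobianMatrix (fun i => f i (τ k₀.2)) (fun i => deriv (f i) (τ k₀.2))
          (Function.update τ k₀.2 1) k₀.2) k₀ z).det| *
        ENNReal.ofReal ((√(2 * π))⁻¹ ^ (Fintype.card (ι × ρ) * Fintype.card ρ) *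
          rexp (-(∑ k, ∑ r, extendEntry k₀ z
            (solveEntry (kernelWeight f k₀.2 τ) k₀ z) k r ^ 2) / 2)) := by
  set Θ : ({k // k ≠ k₀} → ρ → ℝ) × (ρ → ℝ) → ({k // k ≠ k₀} → ρ → ℝ) × (ρ → ℝ) := fun x => (x.1, solveEntry (kernelWeight f k₀.2 x.2) k₀ x.1) with hΘ
  set Θ' : ({k // k ≠ k₀} → ρ → ℝ) × (ρ → ℝ) →
      (({k // k ≠ k₀} → ρ → ℝ) × (ρ → ℝ)) →L[ℝ] ({k // k ≠ k₀} → ρ → ℝ) × (ρ → ℝ) := fun x => solveEntryDeriv (kernelWeight f k₀.2 x.2)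
        (jacobianMatrix (fun i => f i (x.2 k₀.2)) (fun i => deriv (f i) (x.2 k₀.2))
          (Function.update x.2 k₀.2 1) k₀.2) k₀ x.1 with hΘ'
  set d : (ι × ρ → ρ → ℝ) → ℝ≥0∞ := fun A =>
    ENNReal.ofReal ((√(2 * π))⁻¹ ^ (Fintype.card (ι × ρ) * Fintype.card ρ) *
          rexp (-(∑ k, ∑ r, A k r ^ 2) / 2)) with hd
  have hdm : Measurable d := by fun_prop
  set s : Set (({k // k ≠ k₀} → ρ → ℝ) × (ρ → ℝ)) := {x | x.2 k₀.2 ∈ T} with hs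
  have hsm : MeasurableSet s := by
    have : Measurable fun x : ({k // k ≠ k₀} → ρ → ℝ) × (ρ → ℝ) => x.2 k₀.2 := by fun_prop
    exact this hT
  have hdet : Measurable fun x : ({k // k ≠ k₀} → ρ → ℝ) × (ρ → ℝ) => (Θ' x).det := measurable_det_solveEntryDeriv hf k₀
  set c : (ι × ρ → ρ → ℝ) → ℝ≥0∞ := fun B => ({τ : ρ → ℝ | τ k₀.2 ∈ T ∧
        ∀ r, ∑ k, kernelWeight f k₀.2 τ k * B k r = 0}.encard : ℝ≥0∞) with hc
  have hcount (y : ({k // k ≠ k₀} → ρ → ℝ) × (ρ → ℝ)) : ({x | x ∈ s ∧ Θ x = y}.encard : ℝ≥0∞) = c (extendEntry k₀ y.1 y.2) := by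
    simp only [c]
    suffices h : {x | x ∈ s ∧ Θ x = y} = Prod.mk y.1 '' {τ : ρ → ℝ | τ k₀.2 ∈ T ∧
        ∀ r, ∑ k, kernelWeight f k₀.2 τ k * extendEntry k₀ y.1 y.2 k r = 0} by
      rw [h, (Prod.mk_right_injective y.1).encard_image]
    ext ⟨z, τ⟩
    simp only [mem_ofPred_eq, mem_image, s, Θ, Prod.ext_iff]
    constructor
    · rintro ⟨hτ, h1, h2⟩
      refine ⟨τ, ⟨hτ, ?_⟩, h1.symm, rfl⟩
      rw [sum_mul_extendEntry_eq_zero_iff (by simpa [kernelWeight] using h₀ _ hτ), ← h1, h2]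
    · rintro ⟨τ', ⟨hτ, h⟩, h1, h2⟩
      subst h1 h2
      rw [sum_mul_extendEntry_eq_zero_iff (by simpa [kernelWeight] using h₀ _ hτ)] at h
      exact ⟨hτ, rfl, h⟩
  have := isAddHaarMeasure_volume_pi_prod {k // k ≠ k₀} ρ
  obtain ⟨hm, hval⟩ := lintegral_encard_fiber_mul volume (f := Θ) (f' := Θ') hsm
    (fun x hx => (hasFDerivAt_solveEntry hf k₀ x (h₀ _ hx)).hasFDerivWithinAt)
    (hsm.inter (hdet (measurableSet_singleton 0)))
    (g := fun y => d (extendEntry k₀ y.1 y.2)) (hdm.comp (measurable_extendEntry k₀))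
  simp only [hcount] at hm hval
  have hmp : MeasurePreserving (extendEntryEquiv ρ k₀) := measurePreserving_extendEntry k₀
  have hcm : AEMeasurable c (volume : Measure (ι × ρ → ρ → ℝ)) :=
    (hmp.aemeasurable_comp_iff (extendEntryEquiv ρ k₀).measurableEmbedding).1 hm
  rw [pi_pi_gaussianReal_eq_withDensity]
  refine ⟨hcm.mono_ac (withDensity_absolutelyContinuous _ _), ?_⟩
  rw [lintegral_withDensity_eq_lintegral_mul₀ hdm.aemeasurable hcm, ← hmp.lintegral_comp_emb
    (extendEntryEquiv ρ k₀).measurableEmbedding]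
  simp only [Pi.mul_apply, mul_comm (d _)]
  refine hval.trans ?_
  have hgm : Measurable fun x : ({k // k ≠ k₀} → ρ → ℝ) × (ρ → ℝ) => ENNReal.ofReal |(Θ' x).det| *
      d (extendEntry k₀ (Θ x).1 (Θ x).2) :=
    (hdet.abs.ennreal_ofReal).mul
      ((hdm.comp (measurable_extendEntry k₀)).comp (measurable_solveEntry_kernelWeight hf k₀))
  have hsp : s = univ ×ˢ {τ : ρ → ℝ | τ k₀.2 ∈ T} := by ext; simp [s]
  rw [hsp, Measure.volume_eq_prod, ← Measure.prod_restrict, Measure.restrict_univ,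
    lintegral_prod_symm _ hgm.aemeasurable]

theorem ae_forall_kernel_ne {ι ρ : Type*} [Fintype ι] [DecidableEq ι] [Fintype ρ] [DecidableEq ρ]
    {f : ι → ℝ → ℝ} (hf : ∀ i, Differentiable ℝ (f i)) (k₀ : ι × ρ) {T : Set ℝ}
    (h₀ : ∀ t ∈ T, f k₀.1 t ≠ 0) (l : ρ) :
    ∀ᵐ B : ι × ρ → ρ → ℝ ∂(Measure.pi fun _ => Measure.pi fun _ => gaussianReal 0 1),
      ∀ τ : ρ → ℝ, τ k₀.2 ∈ T → (∀ r, ∑ k, kernelWeight f k₀.2 τ k * B k r = 0) → τ l ≠ 0 := by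
  have := isAddHaarMeasure_volume_pi_prod {k // k ≠ k₀} ρ
  set s : Set (({k // k ≠ k₀} → ρ → ℝ) × (ρ → ℝ)) := {x | x.2 k₀.2 ∈ T ∧ x.2 l = 0} with hs
  have hs0 : volume s = 0 := by
    refine measure_mono_null (t := Prod.snd ⁻¹' {τ : ρ → ℝ | τ l = 0}) (fun x hx => hx.2) ?_
    exact Measure.quasiMeasurePreserving_snd.preimage_null (Measure.pi_hyperplane _ l 0)
  have himage := addHaar_image_eq_zero_of_differentiableOn_of_addHaar_eq_zero volume
    (f := fun x : ({k // k ≠ k₀} → ρ → ℝ) × (ρ → ℝ) =>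
        (x.1, solveEntry (kernelWeight f k₀.2 x.2) k₀ x.1)) (s := s)
    (fun x hx =>
      (hasFDerivAt_solveEntry hf k₀ x (h₀ _ hx.1)).differentiableAt.differentiableWithinAt) hs0
  rw [pi_pi_gaussianReal_eq_withDensity]
  refine (withDensity_absolutelyContinuous _ _).ae_le ?_
  have hmp : MeasurePreserving (extendEntryEquiv ρ k₀).symm :=
    MeasurePreserving.symm _ (measurePreserving_extendEntry k₀)
  filter_upwards [hmp.quasiMeasurePreserving.ae (compl_mem_ae_iff.2 himage)] with B hB τ hτ h hl
  refine hB ⟨(((extendEntryEquiv ρ k₀).symm B).1, τ), ⟨hτ, hl⟩, Prod.ext rfl ?_⟩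
  refine (sum_mul_extendEntry_eq_zero_iff (by simpa [kernelWeight] using h₀ _ hτ) _ _).1 ?_
  have : extendEntry k₀ ((extendEntryEquiv ρ k₀).symm B).1 ((extendEntryEquiv ρ k₀).symm B).2 = B :=
    (extendEntryEquiv ρ k₀).apply_symm_apply B
  rwa [this]

/-- The speed of the projection of the curve `f` to the unit sphere. -/
noncomputable def projectiveSpeed {ι : Type*} [Fintype ι] (f : ι → ℝ → ℝ) (t : ℝ) : ℝ :=
  √(∑ i, deriv (f i) t ^ 2 - (∑ i, f i t * deriv (f i) t) ^ 2 / ∑ i, f i t ^ 2) /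
    √(∑ i, f i t ^ 2)

theorem lintegral_encard_kernel_fin {ι : Type*} [Fintype ι] [DecidableEq ι] {m : ℕ}
    {f : ι → ℝ → ℝ} (hf : ∀ i, Differentiable ℝ (f i)) (i : ι) {T : Set ℝ}
    (hT : MeasurableSet T) (h₀ : ∀ t ∈ T, f i t ≠ 0) :
    ∫⁻ B : ι × Fin (m + 1) → Fin (m + 1) → ℝ, ({τ : Fin (m + 1) → ℝ | τ 0 ∈ T ∧
        ∀ r, ∑ k, kernelWeight f 0 τ k * B k r = 0}.encard : ℝ≥0∞)
      ∂(Measure.pi fun _ => Measure.pi fun _ => gaussianReal 0 1) =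
    ENNReal.ofReal (√π * Gamma (((m + 1 : ℕ) + 1) / 2) / Gamma ((m + 1 : ℕ) / 2)) *
      ((∫⁻ t in T, ENNReal.ofReal (projectiveSpeed f t)) / ENNReal.ofReal π) := by
  refine (lintegral_encard_kernel hf (i, (0 : Fin (m + 1))) hT h₀).2.trans ?_
  have hfm := fun i => (hf i).continuous.measurable
  have hfd := fun i => measurable_deriv (f i)
  have hspeed : Measurable (projectiveSpeed f) := by unfold projectiveSpeed; fun_prop
  set K : ℝ≥0∞ := ENNReal.ofReal ((√(2 * π))⁻¹ ^ (m + 1)) * gaussianAbsDet (Fin (m + 1)) with hK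
  set g : ℝ × (Fin m → ℝ) → ℝ≥0∞ := fun x => ENNReal.ofReal (projectiveSpeed f x.1) *
    ENNReal.ofReal ((√(1 + ∑ i, x.2 i ^ 2))⁻¹ ^ (m + 1)) with hg
  have hgm : Measurable g := by fun_prop
  set e := MeasurableEquiv.piFinSuccAbove (fun _ : Fin (m + 1) => ℝ) 0 with he
  have hinner : ∀ τ ∈ {τ : Fin (m + 1) → ℝ | τ 0 ∈ T},
      (∫⁻ z : {k : ι × Fin (m + 1) // k ≠ (i, 0)} → Fin (m + 1) → ℝ,
        ENNReal.ofReal |(solveEntryDeriv (kernelWeight f 0 τ)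
        (jacobianMatrix (fun i => f i (τ 0)) (fun i => deriv (f i) (τ 0))
          (Function.update τ 0 1) 0) (i, 0) z).det| *
        ENNReal.ofReal ((√(2 * π))⁻¹ ^ (Fintype.card (ι × Fin (m + 1)) * Fintype.card (Fin (m + 1))) *
          rexp (-(∑ k, ∑ r, extendEntry (i, 0) z
            (solveEntry (kernelWeight f 0 τ) (i, 0) z) k r ^ 2) / 2))) = g (e τ) * K := by
    intro τ hτ
    have hfi : f i (τ 0) ≠ 0 := h₀ _ hτ
    have hsum : 0 < ∑ i, f i (τ 0) ^ 2 :=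
      Finset.sum_pos' (fun _ _ => sq_nonneg _) ⟨i, Finset.mem_univ _, by positivity⟩
    obtain ⟨W, hW, hWw⟩ : ∃ W, 0 < W ∧ W ^ 2 = ∑ i, f i (τ 0) ^ 2 :=
      ⟨_, Real.sqrt_pos.2 hsum, Real.sq_sqrt hsum.le⟩
    set c : Fin m → ℝ := fun j => τ j.succ with hc
    have hu : Function.update τ 0 1 = (Fin.cons 1 c : Fin (m + 1) → ℝ) := by
      ext j
      refine Fin.cases ?_ (fun j => ?_) j <;> simp [c]
    have heτ : e τ = (τ 0, c) := rfl
    set U : ℝ := √(1 + ∑ j, c j ^ 2) with hU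
    have hUpos : 0 < U := by positivity
    have hQq : (W * U) ^ 2 = ∑ k, kernelWeight f 0 τ k ^ 2 := by
      simp only [kernelWeight, hu, mul_pow, Fintype.sum_prod_type, ← Finset.mul_sum, ← Finset.sum_mul]
      rw [hWw, hU, Real.sq_sqrt (by positivity), Fin.sum_univ_succ]
      simp
    rw [lintegral_abs_det_solveEntryDeriv _ _ (by simpa [kernelWeight] using hfi)
      (mul_pos hW hUpos) hQq, hu]
    simp only [kernelWeight, hu]
    rw [det_gram_jacobianMatrix (fun i => f i (τ 0)) (fun i => deriv (f i) (τ 0)) c hW hWw rfl]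
    have hsq (σ : ℝ) : √(σ * (W ^ 2) ^ m) = √σ * W ^ m := by
      rw [Real.sqrt_mul' _ (by positivity), ← pow_mul, mul_comm 2 m, pow_mul,
        Real.sqrt_sq (by positivity)]
    simp only [g, heτ, hK, projectiveSpeed, ← hU, ← hWw, Real.sqrt_sq hW.le, hsq, Fintype.card_fin,
      ← mul_assoc]
    congr 1
    rw [← ENNReal.ofReal_mul (by positivity), ← ENNReal.ofReal_mul (by positivity),
      ← ENNReal.ofReal_mul (by positivity)]
    congr 1
    simp only [mul_inv, mul_pow, inv_pow]
    field_simp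
    ring
  refine (setLIntegral_congr_fun ((measurable_pi_apply 0) hT) hinner).trans ?_
  change ∫⁻ τ in {τ : Fin (m + 1) → ℝ | τ 0 ∈ T}, g (e τ) * K = _
  have hpre : {τ : Fin (m + 1) → ℝ | τ 0 ∈ T} = e ⁻¹' (T ×ˢ univ) := by
    ext τ
    simp [e]
  have hgauss : gaussianAbsDet (Fin (m + 1)) ≠ ⊤ := by
    rw [gaussianAbsDet_fin]; exact ENNReal.ofReal_ne_top
  rw [lintegral_mul_const' _ _ (by finiteness), hpre,
    (volume_preserving_piFinSuccAbove (fun _ : Fin (m + 1) => ℝ) 0).setLIntegral_comp_preimage_emb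
      e.measurableEmbedding, Measure.volume_eq_prod, ← Measure.prod_restrict, Measure.restrict_univ]
  rw [show ∫⁻ x, g x ∂((volume.restrict T).prod volume) = _ from
      lintegral_prod_mul (f := fun t => ENNReal.ofReal (projectiveSpeed f t))
        (g := fun c : Fin m → ℝ => ENNReal.ofReal ((√(1 + ∑ i, c i ^ 2))⁻¹ ^ (m + 1)))
        (by fun_prop) (Measurable.aemeasurable (by fun_prop)),
    lintegral_inv_sqrt_one_add_sum_sq_pow, hK, gaussianAbsDet_fin, ENNReal.div_eq_inv_mul,
    ← ENNReal.ofReal_inv_of_pos pi_pos, mul_assoc, ← mul_assoc (ENNReal.ofReal _), mul_comm]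
  have hΓ : 0 < Gamma (((m : ℝ) + 1) / 2) := Gamma_pos_of_pos (by positivity)
  have hΓ' : 0 < Gamma (((m : ℝ) + 1 + 1) / 2) := Gamma_pos_of_pos (by positivity)
  push_cast
  rw [← ENNReal.ofReal_mul (by positivity), ← ENNReal.ofReal_mul (by positivity), ← mul_assoc,
    ← ENNReal.ofReal_mul (by positivity)]
  congr 2
  simp only [Real.sqrt_mul zero_le_two, inv_pow, mul_pow]
  have hπ : √π ^ 2 = π := Real.sq_sqrt pi_pos.le
  field_simp
  exact hπ.symm

theorem sum_kernelWeight_update_mul {ι ρ : Type*} [Fintype ι] [Fintype ρ] [DecidableEq ρ]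
    (f : ι → ℝ → ℝ) (B : ι × ρ → ρ → ℝ) (t : ℝ) {u : ρ → ℝ} {l : ρ} (hu : u l = 1) (r : ρ) :
    ∑ k, kernelWeight f l (Function.update u l t) k * B k r =
      ((Matrix.of fun r c => ∑ i, B (i, c) r * f i t).mulVec u) r := by
  have : Function.update u l 1 = u := by rw [← hu, Function.update_eq_self]
  simp only [kernelWeight, Function.update_self, Function.update_idem, this, Matrix.mulVec,
    dotProduct, Matrix.of_apply, Fintype.sum_prod_type_right, Finset.sum_mul]
  exact Finset.sum_congr rfl fun c _ => Finset.sum_congr rfl fun i _ => by ring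

/-- If no kernel vector has vanishing coordinate `j`, the parameters with a nontrivial kernel
correspond to the kernel vectors normalized at `j`. -/
theorem encard_det_eq_zero {ι ρ : Type*} [Fintype ι] [Fintype ρ] [DecidableEq ρ]
    (f : ι → ℝ → ℝ) (B : ι × ρ → ρ → ℝ) (T : Set ℝ) (j : ρ)
    (hB : ∀ l, l ≠ j → ∀ τ : ρ → ℝ, τ l ∈ T →
      (∀ r, ∑ k, kernelWeight f l τ k * B k r = 0) → τ j ≠ 0) :
    {t | t ∈ T ∧ (Matrix.of fun r c => ∑ i, B (i, c) r * f i t).det = 0}.encard =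
      {τ : ρ → ℝ | τ j ∈ T ∧ ∀ r, ∑ k, kernelWeight f j τ k * B k r = 0}.encard := by
  set M : ℝ → Matrix ρ ρ ℝ := fun t => Matrix.of fun r c => ∑ i, B (i, c) r * f i t with hM
  have hne {t : ℝ} (ht : t ∈ T) {u : ρ → ℝ} (hu : (M t).mulVec u = 0) (huj : u j = 0) : u = 0 := by
    by_contra! h
    obtain ⟨l, hl⟩ := Function.ne_iff.1 h
    simp only [Pi.zero_apply] at hl
    have hlj : l ≠ j := by rintro rfl; exact hl huj
    refine hB l hlj (Function.update ((u l)⁻¹ • u) l t) (by simpa using ht) (fun r => ?_)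
      (by simp [hlj.symm, huj])
    rw [sum_kernelWeight_update_mul f B t (by simp [hl]), Matrix.mulVec_smul, hu]
    simp
  have hker (τ : ρ → ℝ) : (∀ r, ∑ k, kernelWeight f j τ k * B k r = 0) ↔
      (M (τ j)).mulVec (Function.update τ j 1) = 0 := by
    have h := sum_kernelWeight_update_mul f B (τ j) (Function.update_self j 1 τ)
    simp only [Function.update_idem, Function.update_eq_self] at h
    simp only [h, funext_iff, Pi.zero_apply, hM]
  have hinj : InjOn (fun τ : ρ → ℝ => τ j)
      {τ | τ j ∈ T ∧ ∀ r, ∑ k, kernelWeight f j τ k * B k r = 0} := by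
    rintro τ ⟨hτ, hτ'⟩ σ ⟨-, hσ'⟩ (h : τ j = σ j)
    rw [hker] at hτ' hσ'
    rw [← h] at hσ'
    have := hne hτ (u := Function.update τ j 1 - Function.update σ j 1)
      (by rw [Matrix.mulVec_sub, hτ', hσ', sub_zero]) (by simp)
    ext l
    by_cases hl : l = j
    · rw [hl, h]
    · simpa [hl, sub_eq_zero] using congrFun this l
  rw [← hinj.encard_image]
  congr 1
  ext t
  simp only [mem_ofPred_eq, mem_image, hker]
  constructor
  · rintro ⟨ht, hdet⟩
    obtain ⟨u, hu₀, hu⟩ := Matrix.exists_mulVec_eq_zero_iff.2 hdet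
    have huj : u j ≠ 0 := fun h => hu₀ (hne ht hu h)
    have h1 : Function.update ((u j)⁻¹ • u) j 1 = (u j)⁻¹ • u := by
      rw [Function.update_eq_self_iff]
      simp [huj]
    refine ⟨Function.update ((u j)⁻¹ • u) j t, ⟨by simpa using ht, ?_⟩, by simp⟩
    rw [Function.update_idem, Function.update_self, h1, Matrix.mulVec_smul, hu, smul_zero]
  · rintro ⟨τ, ⟨hτ, h⟩, rfl⟩
    refine ⟨hτ, Matrix.exists_mulVec_eq_zero_iff.1 ⟨_, fun h0 => ?_, h⟩⟩
    simpa using congrFun h0 j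

theorem encard_det_ae_eq {ι : Type*} [Fintype ι] [DecidableEq ι] {m : ℕ}
    {f : ι → ℝ → ℝ} (hf : ∀ i, Differentiable ℝ (f i)) (i : ι) {T : Set ℝ}
    (h₀ : ∀ t ∈ T, f i t ≠ 0) :
    (fun B : ι × Fin (m + 1) → Fin (m + 1) → ℝ =>
      ({t | t ∈ T ∧ (Matrix.of fun r c => ∑ i, B (i, c) r * f i t).det = 0}.encard : ℝ≥0∞))
    =ᵐ[Measure.pi fun _ => Measure.pi fun _ => gaussianReal 0 1]
    fun B => ({τ : Fin (m + 1) → ℝ | τ 0 ∈ T ∧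
        ∀ r, ∑ k, kernelWeight f 0 τ k * B k r = 0}.encard : ℝ≥0∞) := by
  filter_upwards [ae_all_iff.2 fun l => ae_forall_kernel_ne hf (i, l) h₀ 0] with B hB
  rw [encard_det_eq_zero f B T 0 fun l _ => hB l]

theorem encard_setOf_iUnion_and {ι X : Type*} [Fintype ι] {T : ι → Set X}
    (hT : Pairwise (Function.onFun Disjoint T)) (P : X → Prop) :
    ({x | x ∈ ⋃ i, T i ∧ P x}.encard : ℝ≥0∞) = ∑ i, ({x | x ∈ T i ∧ P x}.encard : ℝ≥0∞) := by
  have h : {x | x ∈ ⋃ i, T i ∧ P x} = ⋃ i, {x | x ∈ T i ∧ P x} := by ext; simp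
  rw [h, encard_iUnion_of_finite fun i j hij => (hT hij).mono (fun _ hx => hx.1) fun _ hx => hx.1,
    finsum_eq_sum_of_fintype]
  exact map_sum ENat.toENNRealRingHom _ _

theorem lintegral_encard_det {ι : Type*} [Fintype ι] [LinearOrder ι] [LocallyFiniteOrderBot ι]
    {m : ℕ} {f : ι → ℝ → ℝ} (hf : ∀ i, Differentiable ℝ (f i)) {S : Set ℝ} (hS : MeasurableSet S)
    (h₀ : ∀ t ∈ S, ∃ i, f i t ≠ 0) :
    AEMeasurable (fun B : ι × Fin (m + 1) → Fin (m + 1) → ℝ =>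
      ({t | t ∈ S ∧ (Matrix.of fun r c => ∑ i, B (i, c) r * f i t).det = 0}.encard : ℝ≥0∞))
      (Measure.pi fun _ => Measure.pi fun _ => gaussianReal 0 1) ∧
    ∫⁻ B : ι × Fin (m + 1) → Fin (m + 1) → ℝ,
      ({t | t ∈ S ∧ (Matrix.of fun r c => ∑ i, B (i, c) r * f i t).det = 0}.encard : ℝ≥0∞)
      ∂(Measure.pi fun _ => Measure.pi fun _ => gaussianReal 0 1) =
    ENNReal.ofReal (√π * Gamma (((m + 1 : ℕ) + 1) / 2) / Gamma ((m + 1 : ℕ) / 2)) *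
      ((∫⁻ t in S, ENNReal.ofReal (projectiveSpeed f t)) / ENNReal.ofReal π) := by
  set s : ι → Set ℝ := fun i => {t | t ∈ S ∧ f i t ≠ 0} with hs
  have hsm (i) : MeasurableSet (s i) :=
    hS.inter ((hf i).continuous.measurable (measurableSet_singleton 0).compl)
  set T := disjointed s with hTdef
  have hT (i) : MeasurableSet (T i) := disjointedRec (fun _ _ h => h.diff (hsm _)) (hsm i)
  have hTd : Pairwise (Function.onFun Disjoint T) := disjoint_disjointed s
  have hT₀ (i) : ∀ t ∈ T i, f i t ≠ 0 := fun t ht => (disjointed_le s i ht).2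
  have hST : S = ⋃ i, T i := by
    rw [iUnion_disjointed]
    ext t
    simpa [hs] using h₀ t
  have hae (i) := encard_det_ae_eq (m := m) hf i (hT₀ i)
  have hmeas (i) := (lintegral_encard_kernel hf (i, (0 : Fin (m + 1))) (hT i) (hT₀ i)).1.congr
    (hae i).symm
  rw [hST]
  simp only [encard_setOf_iUnion_and hTd]
  refine ⟨Finset.aemeasurable_fun_sum _ fun i _ => hmeas i, ?_⟩
  rw [lintegral_finsetSum' _ fun i _ => hmeas i, lintegral_iUnion hT hTd, tsum_fintype,
    ENNReal.div_eq_inv_mul, ← mul_assoc, Finset.mul_sum]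
  refine Finset.sum_congr rfl fun i _ => ?_
  rw [lintegral_congr_ae (hae i), lintegral_encard_kernel_fin hf i (hT i) (hT₀ i),
    ENNReal.div_eq_inv_mul, mul_assoc]

theorem norm_deriv_normalize_eq_projectiveSpeed {ι : Type*} [Fintype ι] {f : ι → ℝ → ℝ}
    (hf : ∀ i, Differentiable ℝ (f i)) {v : ℝ → EuclideanSpace ℝ ι} (hv : ∀ t i, v t i = f i t)
    {t : ℝ} (h₀ : v t ≠ 0) :
    ‖deriv (fun t => ‖v t‖⁻¹ • v t) t‖ = projectiveSpeed f t := by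
  have hd : HasDerivAt v (WithLp.toLp 2 fun i => deriv (f i) t) t := by
    have hpi : HasDerivAt (fun t i => f i t) (fun i => deriv (f i) t) t :=
      hasDerivAt_pi.2 fun i => (hf i t).hasDerivAt
    have hveq : v = fun t => WithLp.toLp 2 fun i => f i t := by
      ext t i
      exact hv t i
    rw [hveq]
    exact (PiLp.continuousLinearEquiv 2 ℝ fun _ : ι => ℝ).symm.hasFDerivAt.comp_hasDerivAt t hpi
  rw [norm_deriv_normalize hd h₀, projectiveSpeed]
  simp [EuclideanSpace.norm_eq, PiLp.inner_apply, hv, Real.sq_sqrt, Finset.sum_nonneg, sq_nonneg,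
    mul_comm]

theorem measurePreserving_transpose_uncurry {ι ρ X : Type*} [Fintype ι] [Fintype ρ]
    [MeasurableSpace X] (μ : Measure X) [SigmaFinite μ] :
    MeasurePreserving (fun (A : ι → ρ → ρ → X) (k : ι × ρ) (r : ρ) => A k.1 r k.2)
      (Measure.pi fun _ => Measure.pi fun _ => Measure.pi fun _ => μ)
      (Measure.pi fun _ => Measure.pi fun _ => μ) :=
  (measurePreserving_uncurry (Measure.pi fun _ : ρ => μ)).comp
    (measurePreserving_pi _ _ fun _ => measurePreserving_flip μ)

/-- Theorem 6.1 (identity covariance case): for `p×p` matrices `A₀, …, Aₙ` with iid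
standard normal entries, the expected number of `t ∈ [a,b]` with
`det(A₀f₀(t) + ⋯ + Aₙfₙ(t)) = 0` is the `p = 1` answer `(1/π)∫ₐᵇ ‖γ'(t)‖ dt`
multiplied by the factor `√π Γ((p+1)/2)/Γ(p/2)`. -/
theorem matrix_polynomial_real_eigenvalues (p : ℕ) (hp : 1 ≤ p) (n : ℕ)
    (f : Fin (n + 1) → ℝ → ℝ) (hf : ∀ i, Differentiable ℝ (f i))
    (v : ℝ → EuclideanSpace ℝ (Fin (n + 1)))
    (hv : ∀ t i, v t i = f i t) (hv0 : ∀ t, v t ≠ 0)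
    (γ : ℝ → EuclideanSpace ℝ (Fin (n + 1)))
    (hγ : ∀ t, γ t = ‖v t‖⁻¹ • v t)
    (a b : ℝ) (hab : a < b) :
    ∫⁻ A : Fin (n + 1) → Fin p → Fin p → ℝ,
        ({t : ℝ | t ∈ Set.Icc a b ∧
          (Matrix.of fun r c : Fin p =>
            ∑ i : Fin (n + 1), A i r c * f i t).det = 0}.encard : ℝ≥0∞)
        ∂(Measure.pi fun _ => Measure.pi fun _ => Measure.pi fun _ =>
            gaussianReal 0 1)
      = ENNReal.ofReal
          (Real.sqrt π * Real.Gamma (((p : ℝ) + 1) / 2) / Real.Gamma ((p : ℝ) / 2))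
        * ((∫⁻ t in Set.Icc a b, ENNReal.ofReal ‖deriv γ t‖) / ENNReal.ofReal π) := by
  obtain ⟨m, rfl⟩ := Nat.exists_eq_add_of_le' hp
  have h₀ : ∀ t ∈ Icc a b, ∃ i, f i t ≠ 0 := by
    intro t _
    by_contra! h
    exact hv0 t (by ext i; simp [hv, h])
  obtain ⟨hmeas, hval⟩ := lintegral_encard_det (m := m) hf (S := Icc a b) measurableSet_Icc h₀
  have hφ := measurePreserving_transpose_uncurry (ι := Fin (n + 1)) (ρ := Fin (m + 1))
    (gaussianReal 0 1)
  simp only [funext hγ, norm_deriv_normalize_eq_projectiveSpeed hf hv (hv0 _)]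
  rw [← hval, ← hφ.map_eq, lintegral_map' (hφ.map_eq ▸ hmeas) hφ.aemeasurable]
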